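/- Fix integers l ≥ 1 and e ≥ 2, let s ∈ S_e and let (λ,s) be cylindric and not FLOTW, so that the reduction ψ(λ) (charged by ξ(s) = (s_l − e, s_1, …, s_{l−1})) is defined. Then for every i ∈ {0,…,e−1} the map ψ commutes with the crystal operator f̃_i: if f̃_i acts nontrivially on λ (i.e. λ has a good addable i-node), then f̃_i also acts nontrivially on ψ(λ) and f̃_i(ψ(λ)) = ψ(f̃_i(λ)); here f̃_i(λ) is computed with the charge s, f̃_i(ψ(λ)) with the charge ξ(s), and ψ(f̃_i(λ)) is defined since f̃_i(λ) is again cylindric. (In other words, ψ is a crystal isomorphism between the connected crystal components of (λ,s) and of (ψ(λ),ξ(s)).) -/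

import Mathlib

namespace FockCrystal

/-- A partition: `part a` is the `a`-th part, for `a ≥ 1`; `part 0` is a dummy value `0`. -/
structure Partition where
  part : ℕ → ℕ
  part_zero : part 0 = 0
  antitone : ∀ a : ℕ, 1 ≤ a → part (a + 1) ≤ part a
  eventually_zero : ∃ N : ℕ, ∀ a : ℕ, N ≤ a → part a = 0

/-- A multipartition with `l + 1` components. -/
abbrev MultiPartition (l : ℕ) := Fin (l + 1) → Partition

/-- A node `(a, b, c)`: row `a ≥ 1`, column `b ≥ 1`, component `c`. -/
structure Node (l : ℕ) where
  row : ℕ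
  col : ℕ
  comp : Fin (l + 1)

variable {l : ℕ}

def IsNode (Λ : MultiPartition l) (γ : Node l) : Prop :=
  1 ≤ γ.row ∧ 1 ≤ γ.col ∧ γ.col ≤ (Λ γ.comp).part γ.row

/-- The content `b − a + s_c` of a node. -/
def content (s : Fin (l + 1) → ℤ) (γ : Node l) : ℤ :=
  (γ.col : ℤ) - (γ.row : ℤ) + s γ.comp

/-- `γ` is a removable node of `Λ`. -/
def Removable (Λ : MultiPartition l) (γ : Node l) : Prop :=
  1 ≤ γ.row ∧ 1 ≤ γ.col ∧ γ.col = (Λ γ.comp).part γ.row ∧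
    (Λ γ.comp).part (γ.row + 1) < (Λ γ.comp).part γ.row

/-- `γ` is an addable node of `Λ`. -/
def Addable (Λ : MultiPartition l) (γ : Node l) : Prop :=
  1 ≤ γ.row ∧ γ.col = (Λ γ.comp).part γ.row + 1 ∧
    (γ.row = 1 ∨ (Λ γ.comp).part γ.row < (Λ γ.comp).part (γ.row - 1))

/-- The strict order `≺_s` on nodes. -/
def NodeLt (s : Fin (l + 1) → ℤ) (γ γ' : Node l) : Prop :=
  content s γ < content s γ' ∨ (content s γ = content s γ' ∧ γ'.comp < γ.comp)

inductive Letter | A | R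
  deriving DecidableEq

/-- The letter attached to a node is `A` iff the node is addable, `R` iff removable. -/
def LetterOk (Λ : MultiPartition l) (p : Node l × Letter) : Prop :=
  (p.2 = Letter.A ↔ Addable Λ p.1) ∧ (p.2 = Letter.R ↔ Removable Λ p.1)

/-- `w` is the `i`-word of `(Λ, s)` for the residue-mod-`e` structure: the list of
addable/removable nodes of residue `i`, in increasing `≺_s`-order, with letters A/R. -/
def IsWordE (Λ : MultiPartition l) (s : Fin (l + 1) → ℤ) (e : ℕ) (i : ℤ)
    (w : List (Node l × Letter)) : Prop :=
  w.Pairwise (fun p q => NodeLt s p.1 q.1) ∧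
  (∀ γ : Node l, (∃ x, (γ, x) ∈ w) ↔
      ((Addable Λ γ ∨ Removable Λ γ) ∧ content s γ % (e : ℤ) = i)) ∧
  ∀ p ∈ w, LetterOk Λ p

/-- `w` is the `j`-word of `(Λ, s)` for the `e = ∞` structure: the list of
addable/removable nodes of content `j`, in increasing `≺_s`-order, with letters A/R. -/
def IsWordInf (Λ : MultiPartition l) (s : Fin (l + 1) → ℤ) (j : ℤ)
    (w : List (Node l × Letter)) : Prop :=
  w.Pairwise (fun p q => NodeLt s p.1 q.1) ∧
  (∀ γ : Node l, (∃ x, (γ, x) ∈ w) ↔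
      ((Addable Λ γ ∨ Removable Λ γ) ∧ content s γ = j)) ∧
  ∀ p ∈ w, LetterOk Λ p

/-- Recursive cancellation of all factors `RA` in a word (of nodes with letters). -/
def reduceW : List (Node l × Letter) → List (Node l × Letter)
  | [] => []
  | p :: ps =>
    match reduceW ps with
    | [] => [p]
    | q :: qs => if p.2 = Letter.R ∧ q.2 = Letter.A then qs else p :: q :: qs

/-- `γ` is the node encoded by the rightmost `A` of the reduced word of `w`. -/
def GoodAddableWord (w : List (Node l × Letter)) (γ : Node l) : Prop :=
  ∃ u v, reduceW w = u ++ (γ, Letter.A) :: v ∧ ∀ p ∈ v, p.2 = Letter.R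

/-- `γ` is the node encoded by the leftmost `R` of the reduced word of `w`. -/
def GoodRemovableWord (w : List (Node l × Letter)) (γ : Node l) : Prop :=
  ∃ u v, reduceW w = u ++ (γ, Letter.R) :: v ∧ ∀ p ∈ u, p.2 = Letter.A

/-- `γ` is the good addable `i`-node of `(Λ, s)` for the residue-mod-`e` structure. -/
def GoodAddable (Λ : MultiPartition l) (s : Fin (l + 1) → ℤ) (e : ℕ) (i : ℤ)
    (γ : Node l) : Prop :=
  ∃ w, IsWordE Λ s e i w ∧ GoodAddableWord w γ

/-- `γ` is the good removable `i`-node of `(Λ, s)` for the residue-mod-`e` structure. -/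
def GoodRemovable (Λ : MultiPartition l) (s : Fin (l + 1) → ℤ) (e : ℕ) (i : ℤ)
    (γ : Node l) : Prop :=
  ∃ w, IsWordE Λ s e i w ∧ GoodRemovableWord w γ

/-- `γ` is the good addable `j`-node of `(Λ, s)` for the `e = ∞` structure. -/
def GoodAddableInf (Λ : MultiPartition l) (s : Fin (l + 1) → ℤ) (j : ℤ)
    (γ : Node l) : Prop :=
  ∃ w, IsWordInf Λ s j w ∧ GoodAddableWord w γ

/-- `Λ'` is obtained from `Λ` by adding the node `γ`. -/
def AddNode (Λ Λ' : MultiPartition l) (γ : Node l) : Prop :=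
  (Λ' γ.comp).part γ.row = (Λ γ.comp).part γ.row + 1 ∧
  (∀ a : ℕ, a ≠ γ.row → (Λ' γ.comp).part a = (Λ γ.comp).part a) ∧
  ∀ c, c ≠ γ.comp → Λ' c = Λ c

/-- `s ∈ S_e`: `0 ≤ s_c − s_{c'} < e` whenever `c' < c`. -/
def InSe (e : ℕ) (s : Fin (l + 1) → ℤ) : Prop :=
  ∀ c' c : Fin (l + 1), c' < c → 0 ≤ s c - s c' ∧ s c - s c' < (e : ℤ)

/-- `s ∈ D_e`: `0 ≤ s_1 ≤ … ≤ s_l < e`. -/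
def InDe (e : ℕ) (s : Fin (l + 1) → ℤ) : Prop :=
  (∀ c, 0 ≤ s c ∧ s c < (e : ℤ)) ∧ Monotone s

/-- The rotation `c ↦ c + 1` of components. -/
def rho (l : ℕ) : Equiv.Perm (Fin (l + 1)) := finRotate (l + 1)

/-- The cyclage on multicharges: `ξ(s) = (s_l − e, s_1, …, s_{l−1})`. -/
def xiCharge (e : ℕ) (s : Fin (l + 1) → ℤ) : Fin (l + 1) → ℤ :=
  fun c => s ((rho l).symm c) - if c = 0 then (e : ℤ) else 0

/-- The cyclage on multipartitions: `ξ(λ) = (λ^l, λ^1, …, λ^{l−1})`. -/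
def xiMP (Λ : MultiPartition l) : MultiPartition l := fun c => Λ ((rho l).symm c)

/-- The corresponding bijection on nodes: `(a,b,c) ↦ (a,b,c+1)` cyclically. -/
def xiNode (γ : Node l) : Node l := ⟨γ.row, γ.col, rho l γ.comp⟩

/-- The component preceding `c` (cyclically). -/
def prevComp {l : ℕ} (c : Fin (l + 1)) : Fin (l + 1) := (rho l).symm c

/-- `(Λ, s)` is cylindric. -/
def Cylindric (e : ℕ) (s : Fin (l + 1) → ℤ) (Λ : MultiPartition l) : Prop :=
  (∀ c : Fin l, ∀ a : ℕ, 1 ≤ a →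
      (Λ c.succ).part (a + (s c.succ - s c.castSucc).toNat) ≤ (Λ c.castSucc).part a) ∧
  ∀ a : ℕ, 1 ≤ a →
      (Λ 0).part (a + ((e : ℤ) + s 0 - s (Fin.last l)).toNat) ≤ (Λ (Fin.last l)).part a

/-- `γ` is the rightmost node of a part of `Λ` of size `α`. -/
def RightmostAt (Λ : MultiPartition l) (α : ℕ) (γ : Node l) : Prop :=
  1 ≤ γ.row ∧ γ.col = α ∧ (Λ γ.comp).part γ.row = α

/-- The residues of the rightmost nodes of the parts of size `α` cover `{0,…,e−1}`. -/
def Covers (e : ℕ) (s : Fin (l + 1) → ℤ) (Λ : MultiPartition l) (α : ℕ) : Prop :=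
  ∀ r : ℤ, 0 ≤ r → r < (e : ℤ) →
    ∃ γ : Node l, RightmostAt Λ α γ ∧ content s γ % (e : ℤ) = r

/-- `(Λ, s)` is FLOTW. -/
def FLOTW (e : ℕ) (s : Fin (l + 1) → ℤ) (Λ : MultiPartition l) : Prop :=
  Cylindric e s Λ ∧ ∀ α : ℕ, 1 ≤ α → ¬ Covers e s Λ α

/-- `P 0, …, P (e−1)` is the first pseudoperiod of `(Λ, s)`, of width `α`. -/
def IsFirstPseudoperiod (e : ℕ) (s : Fin (l + 1) → ℤ) (Λ : MultiPartition l)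
    (α : ℕ) (P : ℕ → Node l) : Prop :=
  1 ≤ α ∧ Covers e s Λ α ∧ (∀ β : ℕ, α < β → ¬ Covers e s Λ β) ∧
  (∀ i, i < e → RightmostAt Λ α (P i)) ∧
  (∀ γ, RightmostAt Λ α γ → content s γ ≤ content s (P 0)) ∧
  (∀ γ, RightmostAt Λ α γ → content s γ = content s (P 0) → (P 0).comp ≤ γ.comp) ∧
  ∀ i : ℕ, i + 1 < e →
    content s (P (i + 1)) < content s (P i) ∧
    (∀ γ, RightmostAt Λ α γ → content s γ < content s (P i) →
        content s γ ≤ content s (P (i + 1))) ∧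
    ∀ γ, RightmostAt Λ α γ → content s γ = content s (P (i + 1)) →
        (P (i + 1)).comp ≤ γ.comp

/-- `γ` is one of the nodes of the pseudoperiod `P` (of length `e`). -/
def InPseudo (e : ℕ) (P : ℕ → Node l) (γ : Node l) : Prop := ∃ i, i < e ∧ P i = γ

/-- The number of parts of `π` equal to `v`. -/
noncomputable def countParts (π : Partition) (v : ℕ) : ℕ :=
  Nat.card {a : ℕ // 1 ≤ a ∧ π.part a = v}

/-- `N^{>α}_c`: the number of parts of `Λ^c` greater than `α`. -/
noncomputable def NgtA (Λ : MultiPartition l) (α : ℕ) (c : Fin (l + 1)) : ℕ :=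
  Nat.card {a : ℕ // 1 ≤ a ∧ α < (Λ c).part a}

/-- `N^α_c`: the number of parts of `Λ^c` (equal to `α`) whose rightmost node is in `P`. -/
noncomputable def NalP (e : ℕ) (P : ℕ → Node l) (c : Fin (l + 1)) : ℕ :=
  Nat.card {i : ℕ // i < e ∧ (P i).comp = c}

/-- The number of rows of component `c` above row `r` whose rightmost node is in `P`. -/
noncomputable def PAbove (e : ℕ) (P : ℕ → Node l) (c : Fin (l + 1)) (r : ℕ) : ℕ :=
  Nat.card {i : ℕ // i < e ∧ (P i).comp = c ∧ (P i).row < r}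

/-- `μ = ψ(Λ)`: for each component `C`, `μ^C` consists of the parts of `Λ^C` smaller
than `α`, the parts of `Λ^C` equal to `α` whose rightmost node is not in `P`, and the
parts of `Λ^{C−1}` (cyclically) greater than `α`; specified via part multiplicities. -/
def IsPsi (e : ℕ) (P : ℕ → Node l) (α : ℕ) (Λ μ : MultiPartition l) : Prop :=
  ∀ C : Fin (l + 1), ∀ v : ℕ, 1 ≤ v →
    countParts (μ C) v =
      if v < α then countParts (Λ C) v
      else if v = α then countParts (Λ C) α - NalP e P C
      else countParts (Λ (prevComp C)) v

/-- The canonical association between nodes of `Λ` (outside the rows of `P`) and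
nodes of `ψ(Λ)`: boxes of parts `> α` keep their row and move one component up
(cyclically), boxes of kept parts `≤ α` stay in their component, their row being
shifted by the number of rows removed above minus the number of rows inserted above. -/
def CanonAssoc (e : ℕ) (Λ : MultiPartition l) (α : ℕ) (P : ℕ → Node l)
    (γ Γ : Node l) : Prop :=
  Γ.col = γ.col ∧
  ( (α < (Λ γ.comp).part γ.row ∧ Γ.comp = rho l γ.comp ∧ Γ.row = γ.row)
  ∨ ((Λ γ.comp).part γ.row ≤ α ∧
      (∀ i, i < e → ¬ ((P i).comp = γ.comp ∧ (P i).row = γ.row)) ∧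
      Γ.comp = γ.comp ∧
      Γ.row + NgtA Λ α γ.comp + PAbove e P γ.comp γ.row
        = γ.row + NgtA Λ α (prevComp γ.comp)) )

/-- The entry of the `s`-symbol of `Λ` of size `p` in row `c` and column `k`
(`1 ≤ k ≤ p + s_c`): `b^c_a = λ^c_a − a + p + s_c` with `a = p + s_c − k + 1`. -/
def symbolEntry (s : Fin (l + 1) → ℤ) (Λ : MultiPartition l) (p : ℤ)
    (c : Fin (l + 1)) (k : ℕ) : ℤ :=
  ((Λ c).part (p + s c - (k : ℤ) + 1).toNat : ℤ) - (p + s c - (k : ℤ) + 1) + p + s c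

/-- `p` is an admissible size for the `s`-symbol of `Λ`:
`p ≥ 1 − s_c + h(λ^c)` for all `c`. -/
def SizeOK (s : Fin (l + 1) → ℤ) (Λ : MultiPartition l) (p : ℤ) : Prop :=
  ∀ c, 1 ≤ p + s c ∧ ∀ a : ℕ, p + s c ≤ (a : ℤ) → (Λ c).part a = 0

/-- The `s`-symbol of `Λ` of size `p` is semistandard: `s` is non-decreasing, the
entries in each column are non-decreasing (read from the row with the larger index
down to the row with the smaller one), and the entries in each row are increasing. -/
def SemistandardAt (s : Fin (l + 1) → ℤ) (Λ : MultiPartition l) (p : ℤ) : Prop :=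
  Monotone s ∧
  (∀ c c' : Fin (l + 1), c < c' → ∀ k : ℕ, 1 ≤ k → (k : ℤ) ≤ p + s c →
      symbolEntry s Λ p c' k ≤ symbolEntry s Λ p c k) ∧
  ∀ c, ∀ k : ℕ, 1 ≤ k → (k : ℤ) + 1 ≤ p + s c →
      symbolEntry s Λ p c k < symbolEntry s Λ p c (k + 1)

/-- The `s`-symbol of `Λ` is semistandard (for every admissible size). -/
def Semistandard (s : Fin (l + 1) → ℤ) (Λ : MultiPartition l) : Prop :=
  ∀ p : ℤ, SizeOK s Λ p → SemistandardAt s Λ p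

/-- The index of the column of the symbol of size `p` containing the entry
corresponding to the node `γ`. -/
def colOf (s : Fin (l + 1) → ℤ) (p : ℤ) (γ : Node l) : ℤ :=
  p + s γ.comp - (γ.row : ℤ) + 1


/-- The concatenation, from row `m + n - 1` down to row `m`, of the letters attached to rows. -/
def rowWord {β : Type*} (o : ℤ → Option β) (m : ℤ) : ℕ → List β
  | 0 => []
  | n + 1 => (o (m + n)).toList ++ rowWord o m n

/-- The weight of a row: `1` for a letter `A`, `-1` for a letter `R`, `0` without letter. -/
def letterWeight : Option (Node l × Letter) → ℤ
  | none => 0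
  | some (_, Letter.A) => 1
  | some (_, Letter.R) => -1

/-- `c₀` is the last point where `G` attains its minimum. -/
def LastMin (G : ℤ → ℤ) (c₀ : ℤ) : Prop :=
  (∀ c, G c₀ ≤ G c) ∧ ∀ c, c₀ < c → G c₀ < G c

theorem LastMin.unique {G : ℤ → ℤ} {c d : ℤ} (hc : LastMin G c) (hd : LastMin G d) : c = d := by
  rcases lt_trichotomy c d with h | h | h
  · have := hc.2 d h
    have := hd.1 c
    omega
  · exact h
  · have := hd.2 c h
    have := hc.1 d
    omega

theorem reduceW_cons_A (γ : Node l) (w : List (Node l × Letter)) :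
    reduceW ((γ, Letter.A) :: w) = (γ, Letter.A) :: reduceW w := by
  rw [reduceW]
  cases reduceW w <;> simp

theorem reduceW_cons_R_of_A {γ : Node l} {w u : List (Node l × Letter)} {q : Node l × Letter}
    (h : reduceW w = q :: u) (hq : q.2 = Letter.A) :
    reduceW ((γ, Letter.R) :: w) = u := by
  rw [reduceW, h]
  simp [hq]

theorem reduceW_cons_R_of_R {γ : Node l} {w : List (Node l × Letter)}
    (h : ∀ p ∈ reduceW w, p.2 = Letter.R) :
    reduceW ((γ, Letter.R) :: w) = (γ, Letter.R) :: reduceW w := by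
  rw [reduceW]
  cases hw : reduceW w with
  | nil => simp
  | cons q u =>
    have := h q (by simp [hw])
    simp [this]

theorem reduceW_rowWord (o : ℤ → Option (Node l × Letter)) (m : ℤ) (G : ℤ → ℤ)
    (hG : ∀ c, G (c + 1) = G c + letterWeight (o c)) (n : ℕ) :
    ∃ as rs, reduceW (rowWord o m n) = as ++ rs ∧ (∀ p ∈ as, p.2 = Letter.A) ∧
      (∀ p ∈ rs, p.2 = Letter.R) ∧
      ((as = [] ∧ ∀ c, m ≤ c → c ≤ m + n → G (m + n) ≤ G c) ∨
        ∃ as' c₀ γ, as = as' ++ [(γ, Letter.A)] ∧ m ≤ c₀ ∧ c₀ < m + n ∧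
          o c₀ = some (γ, Letter.A) ∧ G (m + n) = G c₀ + 1 + as'.length ∧
          (∀ c, m ≤ c → c ≤ m + n → G c₀ ≤ G c) ∧
          ∀ c, c₀ < c → c ≤ m + n → G c₀ < G c) := by
  induction n with
  | zero =>
    refine ⟨[], [], rfl, by simp, by simp, Or.inl ⟨rfl, fun c h1 h2 => ?_⟩⟩
    have : c = m := by push_cast at h2; omega
    simp [this]
  | succ n ih =>
    obtain ⟨as, rs, hred, has, hrs, hcase⟩ := ih
    have hstep := hG (m + n)
    have hcast : m + ((n + 1 : ℕ) : ℤ) = m + n + 1 := by push_cast; ring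
    rw [hcast, rowWord]
    cases ho : o (m + n) with
    | none =>
      rw [ho] at hstep
      simp only [letterWeight, add_zero] at hstep
      refine ⟨as, rs, by simpa using hred, has, hrs, ?_⟩
      rcases hcase with ⟨h0, hmin⟩ | ⟨as', c₀, γ, h1, h2, h3, h4, h5, h6, h7⟩
      · refine Or.inl ⟨h0, fun c hc hc' => ?_⟩
        rcases eq_or_lt_of_le hc' with rfl | hlt
        · exact le_rfl
        · rw [hstep]; exact hmin c hc (by omega)
      · refine Or.inr ⟨as', c₀, γ, h1, h2, by omega, h4, by omega, fun c hc hc' => ?_,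
          fun c hc hc' => ?_⟩
        · rcases eq_or_lt_of_le hc' with rfl | hlt
          · omega
          · exact h6 c hc (by omega)
        · rcases eq_or_lt_of_le hc' with rfl | hlt
          · omega
          · exact h7 c hc (by omega)
    | some p =>
      obtain ⟨δ, x⟩ := p
      rw [ho] at hstep
      cases x with
      | A =>
        simp only [letterWeight] at hstep
        refine ⟨(δ, Letter.A) :: as, rs, ?_, by simpa using has, hrs, Or.inr ?_⟩
        · simp [reduceW_cons_A, hred]
        rcases hcase with ⟨h0, hmin⟩ | ⟨as', c₀, γ, h1, h2, h3, h4, h5, h6, h7⟩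
        · refine ⟨[], m + n, δ, by simp [h0], by omega, by omega, ho, by simp; omega,
            fun c hc hc' => ?_, fun c hc hc' => ?_⟩
          · rcases eq_or_lt_of_le hc' with rfl | hlt
            · omega
            · exact hmin c hc (by omega)
          · obtain rfl : c = m + n + 1 := by omega
            omega
        · refine ⟨(δ, Letter.A) :: as', c₀, γ, by simp [h1], h2, by omega, h4,
            by simp; omega, fun c hc hc' => ?_, fun c hc hc' => ?_⟩
          · rcases eq_or_lt_of_le hc' with rfl | hlt
            · omega
            · exact h6 c hc (by omega)
          · rcases eq_or_lt_of_le hc' with rfl | hlt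
            · omega
            · exact h7 c hc (by omega)
      | R =>
        simp only [letterWeight] at hstep
        rcases hcase with ⟨h0, hmin⟩ | ⟨as', c₀, γ, h1, h2, h3, h4, h5, h6, h7⟩
        · subst h0
          refine ⟨[], (δ, Letter.R) :: rs, ?_, by simp, by simpa using hrs,
            Or.inl ⟨rfl, fun c hc hc' => ?_⟩⟩
          · simp only [Option.toList_some, List.singleton_append, List.nil_append] at hred ⊢
            rw [reduceW_cons_R_of_R (by rw [hred]; exact hrs), hred]
          · rcases eq_or_lt_of_le hc' with rfl | hlt
            · exact le_rfl
            · have := hmin c hc (by omega)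
              omega
        · cases as' with
          | nil =>
            subst h1
            refine ⟨[], rs, ?_, by simp, hrs, Or.inl ⟨rfl, fun c hc hc' => ?_⟩⟩
            · simp only [List.nil_append, List.singleton_append] at hred
              simpa using reduceW_cons_R_of_A (γ := δ) hred rfl
            · simp only [List.length_nil] at h5
              rcases eq_or_lt_of_le hc' with rfl | hlt
              · exact le_rfl
              · have := h6 c hc (by omega)
                push_cast at h5
                omega
          | cons a as'' =>
            subst h1
            have ha : a.2 = Letter.A := has a (by simp)
            refine ⟨as'' ++ [(γ, Letter.A)], rs, ?_, fun p hp => has p (by simp_all), hrs,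
              Or.inr ⟨as'', c₀, γ, rfl, h2, by omega, h4, ?_, fun c hc hc' => ?_,
                fun c hc hc' => ?_⟩⟩
            · simp only [List.cons_append] at hred
              simpa using reduceW_cons_R_of_A (γ := δ) hred ha
            · simp only [List.length_cons] at h5
              push_cast at h5
              omega
            · rcases eq_or_lt_of_le hc' with rfl | hlt
              · simp only [List.length_cons] at h5
                push_cast at h5
                omega
              · exact h6 c hc (by omega)
            · rcases eq_or_lt_of_le hc' with rfl | hlt
              · simp only [List.length_cons] at h5
                push_cast at h5
                omega
              · exact h7 c hc (by omega)

/-- The good addable node sits in the row where the potential `G` of the weights attains its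
minimum for the last time. -/
theorem goodAddableWord_rowWord_iff (o : ℤ → Option (Node l × Letter)) (m : ℤ) (n : ℕ)
    (G : ℤ → ℤ) (hG : ∀ c, G (c + 1) = G c + letterWeight (o c))
    (hlo : ∀ c, c ≤ m → G c = G m) (hhi : ∀ c, m + n ≤ c → G c = G (m + n)) (γ : Node l) :
    GoodAddableWord (rowWord o m n) γ ↔ ∃ c, LastMin G c ∧ o c = some (γ, Letter.A) := by
  obtain ⟨as, rs, hred, has, hrs, hcase⟩ := reduceW_rowWord o m G hG n
  have hfas : as.filter (fun p => p.2 = Letter.A) = as :=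
    List.filter_eq_self.2 (fun p hp => by simp [has p hp])
  have hfrs : ∀ v : List (Node l × Letter), (∀ p ∈ v, p.2 = Letter.R) →
      v.filter (fun p => p.2 = Letter.A) = [] := fun v hv =>
    List.filter_eq_nil_iff.2 (fun p hp => by simp [hv p hp])
  rcases hcase with ⟨h0, hmin⟩ | ⟨as', c₀, γ₀, h1, h2, h3, h4, h5, h6, h7⟩
  · constructor
    · rintro ⟨u, v, huv, hv⟩
      have := congrArg (List.filter (fun p => p.2 = Letter.A)) (hred.symm.trans huv)
      rw [List.filter_append, List.filter_append, hfas, hfrs rs hrs, h0] at this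
      simp at this
    · rintro ⟨c, ⟨hc1, hc2⟩, hoc⟩
      exfalso
      by_cases hc : c < m + n
      · have h8 := hc2 (m + n) hc
        by_cases hm : m ≤ c
        · have := hmin c hm hc.le
          omega
        · have := hmin m le_rfl (by omega)
          have := hlo c (by omega)
          omega
      · have h8 := hc2 (c + 1) (by omega)
        have := hhi c (by omega)
        have := hhi (c + 1) (by omega)
        omega
  · have hlast : LastMin G c₀ := by
      refine ⟨fun c => ?_, fun c hc => ?_⟩
      · by_cases hm : m ≤ c
        · by_cases hc : c ≤ m + n
          · exact h6 c hm hc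
          · rw [hhi c (by omega)]
            exact h6 _ (by omega) le_rfl
        · rw [hlo c (by omega)]
          exact h6 _ le_rfl (by omega)
      · by_cases hc' : c ≤ m + n
        · exact h7 c hc hc'
        · rw [hhi c (by omega)]
          exact h7 _ h3 le_rfl
    constructor
    · rintro ⟨u, v, huv, hv⟩
      have := congrArg (List.filter (fun p => p.2 = Letter.A)) (hred.symm.trans huv)
      rw [List.filter_append, List.filter_append, hfas, hfrs rs hrs, h1, List.append_nil,
        List.filter_cons_of_pos (by simp), hfrs v hv] at this
      have hγ := (List.append_inj' this rfl).2
      simp only [List.cons.injEq, Prod.mk.injEq, and_true] at hγ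
      exact ⟨c₀, hlast, by rw [h4, hγ]⟩
    · rintro ⟨c, hc, hoc⟩
      obtain rfl := hc.unique hlast
      rw [h4] at hoc
      simp only [Option.some.injEq, Prod.mk.injEq, and_true] at hoc
      exact ⟨as', rs, by rw [hred, h1, hoc]; simp, hrs⟩

/-- The number of parts of `π` that are at least `v` (for `v ≥ 1`). -/
noncomputable def colLength (π : Partition) (v : ℕ) : ℕ := sInf {n | π.part (n + 1) < v}

theorem Partition.part_le_part (π : Partition) {a b : ℕ} (ha : 1 ≤ a) (hab : a ≤ b) :
    π.part b ≤ π.part a := by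
  induction b, hab using Nat.le_induction with
  | base => exact le_rfl
  | succ b hb ih => exact (π.antitone b (by omega)).trans ih

theorem le_part_iff (π : Partition) {v a : ℕ} (hv : 1 ≤ v) (ha : 1 ≤ a) :
    v ≤ π.part a ↔ a ≤ colLength π v := by
  have hne : {n | π.part (n + 1) < v}.Nonempty := by
    obtain ⟨N, hN⟩ := π.eventually_zero
    exact ⟨N, by simp [hN (N + 1) (by omega)]; omega⟩
  have hmem : π.part (colLength π v + 1) < v := Nat.sInf_mem hne
  constructor
  · intro h
    by_contra hlt
    have := π.part_le_part (a := colLength π v + 1) (b := a) (by omega) (by omega)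
    omega
  · intro h
    by_contra hlt
    have : colLength π v ≤ a - 1 := Nat.sInf_le (by
      change π.part (a - 1 + 1) < v
      rw [Nat.sub_add_cancel ha]
      omega)
    omega

theorem colLength_anti (π : Partition) {v w : ℕ} (hv : 1 ≤ v) (hvw : v ≤ w) :
    colLength π w ≤ colLength π v := by
  rcases Nat.eq_zero_or_pos (colLength π w) with h | h
  · omega
  · have := (le_part_iff π (by omega : 1 ≤ w) h).2 le_rfl
    exact (le_part_iff π hv h).1 (by omega)

theorem colLength_eventually_zero (π : Partition) :
    ∃ V, ∀ v, V ≤ v → colLength π v = 0 := by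
  refine ⟨π.part 1 + 1, fun v hv => ?_⟩
  by_contra h
  have := (le_part_iff π (by omega : 1 ≤ v) (a := 1) le_rfl).2 (by omega)
  omega

theorem colLength_unique (π : Partition) {v n : ℕ} (hv : 1 ≤ v)
    (h : ∀ a, 1 ≤ a → (v ≤ π.part a ↔ a ≤ n)) : colLength π v = n := by
  have h1 := fun a ha => (le_part_iff π hv (a := a) ha).symm.trans (h a ha)
  have h2 := h1 (colLength π v)
  have h3 := h1 n
  omega

theorem part_eq_iff (π : Partition) {v a : ℕ} (hv : 1 ≤ v) (ha : 1 ≤ a) :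
    π.part a = v ↔ colLength π (v + 1) < a ∧ a ≤ colLength π v := by
  have h1 := le_part_iff π hv ha
  have h2 := le_part_iff π (v := v + 1) (by omega) ha
  omega

theorem countParts_eq (π : Partition) {v : ℕ} (hv : 1 ≤ v) :
    countParts π v = colLength π v - colLength π (v + 1) := by
  rw [countParts, Nat.subtype_card (Finset.Ioc (colLength π (v + 1)) (colLength π v)),
    Nat.card_Ioc]
  intro a
  rw [Finset.mem_Ioc]
  constructor
  · intro h
    have ha : 1 ≤ a := by omega
    exact ⟨ha, (part_eq_iff π hv ha).2 h⟩
  · rintro ⟨ha, h⟩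
    exact (part_eq_iff π hv ha).1 h

theorem addable_iff (Λ : MultiPartition l) (γ : Node l) :
    Addable Λ γ ↔ 1 ≤ γ.col ∧ γ.row = colLength (Λ γ.comp) γ.col + 1 ∧
      (γ.col = 1 ∨ colLength (Λ γ.comp) γ.col < colLength (Λ γ.comp) (γ.col - 1)) := by
  obtain ⟨a, b, c⟩ := γ
  simp only [Addable]
  have key : 1 ≤ a → 1 ≤ b → ((b = (Λ c).part a + 1 ∧ (a = 1 ∨ (Λ c).part a < (Λ c).part (a - 1)))
      ↔ (a = colLength (Λ c) b + 1 ∧ (b = 1 ∨ colLength (Λ c) b < colLength (Λ c) (b - 1)))) := by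
    intro ha hb
    have h1 := le_part_iff (Λ c) hb ha
    have h2 : b = 1 ∨ (b - 1 ≤ (Λ c).part a ↔ a ≤ colLength (Λ c) (b - 1)) := by
      rcases Nat.lt_or_ge 1 b with h | h
      · exact Or.inr (le_part_iff (Λ c) (by omega) ha)
      · left; omega
    have h3 : a = 1 ∨ (b ≤ (Λ c).part (a - 1) ↔ a - 1 ≤ colLength (Λ c) b) := by
      rcases Nat.lt_or_ge 1 a with h | h
      · exact Or.inr (le_part_iff (Λ c) hb (by omega))
      · left; omega
    constructor
    · rintro ⟨h4, h5⟩
      constructor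
      · omega
      · omega
    · rintro ⟨h4, h5⟩
      constructor
      · omega
      · omega
  constructor
  · rintro ⟨ha, hb, h⟩
    have := (key ha (by omega)).1 ⟨hb, h⟩
    exact ⟨by omega, this⟩
  · rintro ⟨hb, ha, h⟩
    have := (key (by omega) hb).2 ⟨ha, h⟩
    exact ⟨by omega, this⟩

theorem removable_iff (Λ : MultiPartition l) (γ : Node l) :
    Removable Λ γ ↔ 1 ≤ γ.col ∧ γ.row = colLength (Λ γ.comp) γ.col ∧
      colLength (Λ γ.comp) (γ.col + 1) < colLength (Λ γ.comp) γ.col := by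
  obtain ⟨a, b, c⟩ := γ
  simp only [Removable]
  have h1 : 1 ≤ b → 1 ≤ a → _ := fun hb ha => le_part_iff (Λ c) (v := b) (a := a) hb ha
  have h2 : 1 ≤ a → _ := fun ha => le_part_iff (Λ c) (v := b + 1) (a := a) (by omega) ha
  have h3 : 1 ≤ b → _ := fun hb => le_part_iff (Λ c) (v := b) (a := a + 1) hb (by omega)
  constructor
  · rintro ⟨ha, hb, h⟩
    have := h1 hb ha
    have := h2 ha
    have := h3 hb
    omega
  · rintro ⟨hb, ha, h⟩
    have := h1 hb (by omega)
    have := h2 (by omega)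
    have := h3 hb
    omega

theorem not_addable_of_removable {Λ : MultiPartition l} {γ : Node l} (h : Removable Λ γ) :
    ¬ Addable Λ γ := fun h' => by
  have := h.2.2.1
  have := h'.2.1
  omega

theorem rightmostAt_iff (Λ : MultiPartition l) {α : ℕ} (hα : 1 ≤ α) (γ : Node l) :
    RightmostAt Λ α γ ↔ γ.col = α ∧ colLength (Λ γ.comp) (α + 1) < γ.row ∧
      γ.row ≤ colLength (Λ γ.comp) α := by
  constructor
  · rintro ⟨h1, h2, h3⟩
    exact ⟨h2, (part_eq_iff _ hα h1).1 h3⟩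
  · rintro ⟨h2, h3⟩
    have h1 : 1 ≤ γ.row := by omega
    exact ⟨h1, h2, (part_eq_iff _ hα h1).2 h3⟩

theorem colLength_addNode {Λ Λ' : MultiPartition l} {γ : Node l} (hγ : Addable Λ γ)
    (h : AddNode Λ Λ' γ) (c : Fin (l + 1)) {v : ℕ} (hv : 1 ≤ v) :
    colLength (Λ' c) v =
      colLength (Λ c) v + if c = γ.comp ∧ v = γ.col then 1 else 0 := by
  obtain ⟨h1, h2, h3⟩ := h
  by_cases hc : c = γ.comp
  · subst hc
    refine colLength_unique _ hv fun a ha => ?_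
    have key := le_part_iff (Λ γ.comp) hv ha
    obtain ⟨hb, hr, -⟩ := (addable_iff Λ γ).1 hγ
    have hcol := hγ.2.1
    by_cases hrow : a = γ.row
    · subst hrow
      rw [h1]
      by_cases hvb : v = γ.col
      · subst hvb
        simp only [and_self, if_true]
        omega
      · simp only [hvb, and_false, if_false]
        omega
    · rw [h2 a hrow, key]
      by_cases hvb : v = γ.col
      · subst hvb
        simp only [and_self, if_true]
        omega
      · simp only [hvb, and_false, if_false]
        omega
  · rw [h3 c hc]
    simp [hc]

theorem exists_addNode {Λ : MultiPartition l} {γ : Node l} (hγ : Addable Λ γ) :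
    ∃ Λ', AddNode Λ Λ' γ := by
  obtain ⟨h1, h2, h3⟩ := hγ
  refine ⟨Function.update Λ γ.comp
    { part := Function.update (Λ γ.comp).part γ.row ((Λ γ.comp).part γ.row + 1)
      part_zero := ?_
      antitone := ?_
      eventually_zero := ?_ }, ?_, ?_, ?_⟩
  · rw [Function.update_of_ne (by omega)]
    exact (Λ γ.comp).part_zero
  · intro a ha
    have h4 := (Λ γ.comp).antitone a ha
    by_cases hr : a + 1 = γ.row
    · rw [← hr, Function.update_self, Function.update_of_ne (by omega), hr]
      rcases h3 with h3 | h3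
      · omega
      · have : γ.row - 1 = a := by omega
        rw [this] at h3
        omega
    · rw [Function.update_of_ne hr]
      by_cases hr' : a = γ.row
      · subst hr'
        rw [Function.update_self]
        omega
      · rwa [Function.update_of_ne hr']
  · obtain ⟨N, hN⟩ := (Λ γ.comp).eventually_zero
    refine ⟨N + γ.row + 1, fun a ha => ?_⟩
    rw [Function.update_of_ne (by omega)]
    exact hN a (by omega)
  · simp
  · intro a ha
    simp [ha]
  · intro c hc
    simp [hc]

/-- The component (cyclically) of the extended row index `c ∈ ℤ`. -/
def rowComp (l : ℕ) (c : ℤ) : Fin (l + 1) :=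
  ⟨(c % ((l : ℤ) + 1)).toNat, by
    have h1 := Int.emod_nonneg c (b := (l : ℤ) + 1) (by omega)
    have h2 := Int.emod_lt_of_pos c (b := (l : ℤ) + 1) (by omega)
    omega⟩

/-- The number of full turns of the extended row index `c ∈ ℤ`. -/
def rowLevel (l : ℕ) (c : ℤ) : ℤ := c / ((l : ℤ) + 1)

theorem rowComp_add_rowLevel (l : ℕ) (c : ℤ) :
    c = ((rowComp l c : ℕ) : ℤ) + ((l : ℤ) + 1) * rowLevel l c := by
  have h1 := Int.emod_nonneg c (b := (l : ℤ) + 1) (by omega)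
  have h2 := Int.emod_add_mul_ediv c ((l : ℤ) + 1)
  simp only [rowComp, rowLevel]
  rw [Int.toNat_of_nonneg h1]
  exact h2.symm

theorem row_decomp (l : ℕ) (r : Fin (l + 1)) (k : ℤ) :
    rowComp l ((r : ℕ) + ((l : ℤ) + 1) * k) = r ∧
      rowLevel l ((r : ℕ) + ((l : ℤ) + 1) * k) = k := by
  have hr := r.isLt
  constructor
  · ext
    simp only [rowComp]
    rw [Int.add_mul_emod_self_left, Int.emod_eq_of_lt (by omega) (by omega)]
    simp
  · simp only [rowLevel]
    rw [Int.add_mul_ediv_left _ _ (by omega), Int.ediv_eq_zero_of_lt (by omega) (by omega)]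
    simp

theorem rowComp_coe (r : Fin (l + 1)) : rowComp l ((r : ℕ) : ℤ) = r := by
  simpa using (row_decomp l r 0).1

theorem rowLevel_coe (r : Fin (l + 1)) : rowLevel l ((r : ℕ) : ℤ) = 0 := by
  simpa using (row_decomp l r 0).2

theorem row_turn (l : ℕ) (c : ℤ) : rowComp l (c + ((l : ℤ) + 1)) = rowComp l c ∧
    rowLevel l (c + ((l : ℤ) + 1)) = rowLevel l c + 1 := by
  have h := rowComp_add_rowLevel l c
  have h2 : c + ((l : ℤ) + 1) =
      ((rowComp l c : ℕ) : ℤ) + ((l : ℤ) + 1) * (rowLevel l c + 1) := by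
    linear_combination h
  rw [h2]
  exact row_decomp l _ _

theorem row_step (l : ℕ) (c : ℤ) :
    (((rowComp l c : ℕ) < l ∧ ((rowComp l (c + 1) : ℕ) = rowComp l c + 1) ∧
        rowLevel l (c + 1) = rowLevel l c) ∨
      (rowComp l c = Fin.last l ∧ rowComp l (c + 1) = 0 ∧
        rowLevel l (c + 1) = rowLevel l c + 1)) := by
  have h := rowComp_add_rowLevel l c
  have hlt := (rowComp l c).isLt
  by_cases hl : (rowComp l c : ℕ) < l
  · left
    have h2 : c + 1 = (((⟨rowComp l c + 1, by omega⟩ : Fin (l + 1)) : ℕ) : ℤ) +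
        ((l : ℤ) + 1) * rowLevel l c := by
      push_cast
      linear_combination h
    obtain ⟨h3, h4⟩ := row_decomp l ⟨rowComp l c + 1, by omega⟩ (rowLevel l c)
    rw [← h2] at h3 h4
    exact ⟨hl, by rw [h3], h4⟩
  · right
    have hlast : (rowComp l c : ℕ) = l := by omega
    have h2 : c + 1 = (((0 : Fin (l + 1)) : ℕ) : ℤ) + ((l : ℤ) + 1) * (rowLevel l c + 1) := by
      rw [hlast] at h
      simp only [Fin.val_zero]
      push_cast
      linear_combination h
    obtain ⟨h3, h4⟩ := row_decomp l 0 (rowLevel l c + 1)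
    rw [← h2] at h3 h4
    exact ⟨Fin.ext (by simpa using hlast), h3, h4⟩

theorem rowComp_succ (l : ℕ) (c : ℤ) : rowComp l (c + 1) = rho l (rowComp l c) := by
  rcases row_step l c with ⟨h1, h2, -⟩ | ⟨h1, h2, -⟩
  · ext
    rw [h2, rho, coe_finRotate_of_ne_last]
    intro h
    simp [h] at h1
  · rw [h2, h1, rho, finRotate_last]

theorem rowComp_pred (l : ℕ) (c : ℤ) : rowComp l (c - 1) = prevComp (rowComp l c) := by
  have := rowComp_succ l (c - 1)
  rw [sub_add_cancel] at this
  rw [this, prevComp, Equiv.symm_apply_apply]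

/-- The charge, extended quasi-periodically to all row indices. -/
def chargeExt (e : ℕ) (s : Fin (l + 1) → ℤ) (c : ℤ) : ℤ :=
  s (rowComp l c) + rowLevel l c * e

theorem chargeExt_xi (e : ℕ) (s : Fin (l + 1) → ℤ) (c : ℤ) :
    chargeExt e (xiCharge e s) c = chargeExt e s (c - 1) := by
  have h1 := rowComp_pred l c
  rw [chargeExt, chargeExt, xiCharge, h1, prevComp]
  rcases row_step l (c - 1) with ⟨h2, h3, h4⟩ | ⟨h2, h3, h4⟩ <;>
    rw [sub_add_cancel] at h3 h4
  · have : rowComp l c ≠ 0 := fun h => by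
      rw [h] at h3
      simp at h3
    rw [if_neg this, h4]
    ring
  · rw [if_pos h3, h4]
    ring

theorem chargeExt_turn (e : ℕ) (s : Fin (l + 1) → ℤ) (c : ℤ) :
    chargeExt e s (c + ((l : ℤ) + 1)) = chargeExt e s c + e := by
  rw [chargeExt, chargeExt, (row_turn l c).1, (row_turn l c).2]
  ring

/-- The left end of the parts of size at least `v` in row `c`, in content coordinates: a part of
row `a` (in its component) occupies the position `chargeExt e s c - a`. -/
noncomputable def front (e : ℕ) (s : Fin (l + 1) → ℤ) (Λ : MultiPartition l) (v : ℕ) (c : ℤ) : ℤ :=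
  chargeExt e s c - colLength (Λ (rowComp l c)) v

theorem front_turn (e : ℕ) (s : Fin (l + 1) → ℤ) (Λ : MultiPartition l) (v : ℕ) (c : ℤ) :
    front e s Λ v (c + ((l : ℤ) + 1)) = front e s Λ v c + e := by
  rw [front, front, chargeExt_turn, (row_turn l c).1]
  ring

theorem front_turn_mul (e : ℕ) (s : Fin (l + 1) → ℤ) (Λ : MultiPartition l) (v : ℕ) (c k : ℤ) :
    front e s Λ v (c + ((l : ℤ) + 1) * k) = front e s Λ v c + e * k := by
  induction k using Int.induction_on with
  | zero => simp
  | succ k ih =>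
    have := front_turn e s Λ v (c + ((l : ℤ) + 1) * k)
    rw [ih] at this
    rw [show c + ((l : ℤ) + 1) * ((k : ℤ) + 1) = c + ((l : ℤ) + 1) * k + ((l : ℤ) + 1) by ring,
      this]
    ring
  | pred k ih =>
    have := front_turn e s Λ v (c + ((l : ℤ) + 1) * (-(k : ℤ) - 1))
    rw [show c + ((l : ℤ) + 1) * (-(k : ℤ) - 1) + ((l : ℤ) + 1) = c + ((l : ℤ) + 1) * -(k : ℤ)
      by ring, ih] at this
    linarith

theorem front_le_front (e : ℕ) (s : Fin (l + 1) → ℤ) (Λ : MultiPartition l) {v w : ℕ} (c : ℤ)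
    (hv : 1 ≤ v) (hvw : v ≤ w) : front e s Λ v c ≤ front e s Λ w c := by
  have := colLength_anti (Λ (rowComp l c)) hv hvw
  simp only [front]
  omega

theorem front_monotone_of_cylindric {e : ℕ} {s : Fin (l + 1) → ℤ} {Λ : MultiPartition l}
    (hs : InSe e s) (hcyl : Cylindric e s Λ) {v : ℕ} (hv : 1 ≤ v) :
    Monotone (front e s Λ v) := by
  refine monotone_int_of_le_succ fun c => ?_
  simp only [front, chargeExt]
  rcases row_step l c with ⟨h1, h2, h3⟩ | ⟨h1, h2, h3⟩
  · have hc : rowComp l c = (⟨rowComp l c, h1⟩ : Fin l).castSucc := rfl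
    have hc' : rowComp l (c + 1) = (⟨rowComp l c, h1⟩ : Fin l).succ := Fin.ext (by simpa using h2)
    generalize (⟨rowComp l c, h1⟩ : Fin l) = r at hc hc'
    rw [h3, hc, hc']
    have h4 := hcyl.1 r (colLength (Λ r.castSucc) v + 1) (by omega)
    have h5 := (hs r.castSucc r.succ Fin.castSucc_lt_succ).1
    have h6 := le_part_iff (Λ r.castSucc) hv (a := colLength (Λ r.castSucc) v + 1) (by omega)
    have h7 := le_part_iff (Λ r.succ) hv
      (a := colLength (Λ r.castSucc) v + 1 + (s r.succ - s r.castSucc).toNat) (by omega)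
    have h8 := Int.toNat_of_nonneg h5
    omega
  · rw [h1, h2, h3]
    have h4 := hcyl.2 (colLength (Λ (Fin.last l)) v + 1) (by omega)
    have h5 : 0 ≤ (e : ℤ) + s 0 - s (Fin.last l) := by
      rcases (Fin.zero_le (Fin.last l)).eq_or_lt with h | h
      · rw [← h]
        omega
      · have := (hs 0 (Fin.last l) h).2
        omega
    have h6 := le_part_iff (Λ (Fin.last l)) hv (a := colLength (Λ (Fin.last l)) v + 1) (by omega)
    have h7 := le_part_iff (Λ 0) hv
      (a := colLength (Λ (Fin.last l)) v + 1 + ((e : ℤ) + s 0 - s (Fin.last l)).toNat) (by omega)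
    have h8 := Int.toNat_of_nonneg h5
    rw [add_mul]
    omega

/-- A non-decreasing function that eventually exceeds any bound on both sides crosses each level
at exactly one place. -/
theorem exists_threshold {g : ℤ → ℤ} (hg : Monotone g) {L e : ℤ} (he : 0 < e)
    (hturn : ∀ c k, g (c + L * k) = g c + e * k) (t : ℤ) :
    ∃ q, ∀ c, g c ≤ t ↔ c ≤ q := by
  have hlow : ∃ c, g c ≤ t := by
    refine ⟨0 + L * (-(|g 0 - t|)), ?_⟩
    rw [hturn]
    have := le_abs_self (g 0 - t)
    nlinarith [abs_nonneg (g 0 - t)]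
  have hbd : ∀ c, g c ≤ t → c ≤ L * (|g 0 - t| + 1) := by
    intro c hc
    by_contra hlt
    have h1 := hg (le_of_not_ge hlt)
    rw [← zero_add (L * _), hturn] at h1
    have := neg_abs_le (g 0 - t)
    nlinarith [abs_nonneg (g 0 - t)]
  obtain ⟨q, hq, hmax⟩ := Int.exists_greatest_of_bdd ⟨_, hbd⟩ hlow
  exact ⟨q, fun c => ⟨hmax c, fun h => (hg h).trans hq⟩⟩

theorem exists_front_threshold {e : ℕ} (he : 0 < e) {s : Fin (l + 1) → ℤ} {Λ : MultiPartition l}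
    {v : ℕ} (hmono : Monotone (front e s Λ v)) (t : ℤ) :
    ∃ q, ∀ c, front e s Λ v c ≤ t ↔ c ≤ q :=
  exists_threshold hmono (L := (l : ℤ) + 1) (e := e) (by omega)
    (front_turn_mul e s Λ v) t

theorem covers_iff {e : ℕ} (he : 0 < e) {s : Fin (l + 1) → ℤ} {Λ : MultiPartition l}
    (hmono : ∀ v, 1 ≤ v → Monotone (front e s Λ v)) {α : ℕ} (hα : 1 ≤ α) :
    Covers e s Λ α ↔ ∀ c, front e s Λ α (c + 1) ≤ front e s Λ (α + 1) c := by
  constructor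
  · intro h c
    by_contra hlt
    push Not at hlt
    obtain ⟨γ, hγ, hres⟩ := h ((α + front e s Λ (α + 1) c) % e)
      (Int.emod_nonneg _ (by omega)) (Int.emod_lt_of_pos _ (by omega))
    obtain ⟨hcol, h1, h2⟩ := (rightmostAt_iff Λ hα γ).1 hγ
    obtain ⟨k, hk⟩ := Int.ModEq.dvd (n := (e : ℤ)) hres
    obtain ⟨h3, h4⟩ := row_decomp l γ.comp k
    set d : ℤ := (γ.comp : ℕ) + ((l : ℤ) + 1) * k with hd
    have h5 : front e s Λ α d ≤ front e s Λ (α + 1) c := by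
      simp only [content, hcol] at hk
      rw [front, chargeExt, h3, h4]
      have : k * (e : ℤ) = e * k := mul_comm _ _
      omega
    have h6 : front e s Λ (α + 1) c < front e s Λ (α + 1) d := by
      simp only [content, hcol] at hk
      rw [front.eq_def e s Λ (α + 1) d, chargeExt, h3, h4]
      have : k * (e : ℤ) = e * k := mul_comm _ _
      omega
    rcases le_or_gt d c with hdc | hdc
    · have := hmono (α + 1) (by omega) hdc
      omega
    · have := hmono α hα (show c + 1 ≤ d by omega)
      omega
  · intro h r hr hre
    obtain ⟨q, hq⟩ := exists_front_threshold he (hmono (α + 1) (by omega)) (r - α)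
    have h1 := (hq q).2 le_rfl
    have h2 := h q
    have h3 := mt (hq (q + 1)).1 (by omega)
    refine ⟨⟨(chargeExt e s (q + 1) - (r - α)).toNat, α, rowComp l (q + 1)⟩, ?_, ?_⟩
    · rw [rightmostAt_iff Λ hα]
      simp only [front] at h1 h2 h3 ⊢
      refine ⟨trivial, ?_, ?_⟩ <;> omega
    · have h4 : content s (⟨(chargeExt e s (q + 1) - (r - α)).toNat, α, rowComp l (q + 1)⟩ : Node l)
          = r - e * rowLevel l (q + 1) := by
        simp only [front] at h1 h2 h3
        simp only [content]
        rw [Int.toNat_of_nonneg (by omega), chargeExt]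
        ring
      rw [h4, Int.sub_mul_emod_self_left, Int.emod_eq_of_lt hr hre]

/-- The position of the `b`-th bead in row `c`: the content of the first box to the right of the
parts of size at least `b`. -/
noncomputable def bead (e : ℕ) (s : Fin (l + 1) → ℤ) (Λ : MultiPartition l) (b : ℕ) (c : ℤ) : ℤ :=
  b + front e s Λ b c

theorem bead_lt_bead (e : ℕ) (s : Fin (l + 1) → ℤ) (Λ : MultiPartition l) {b b' : ℕ} (c : ℤ)
    (hb : 1 ≤ b) (hbb : b < b') : bead e s Λ b c < bead e s Λ b' c := by
  have := front_le_front e s Λ c hb hbb.le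
  simp only [bead]
  omega

theorem bead_inj {e : ℕ} {s : Fin (l + 1) → ℤ} {Λ : MultiPartition l} {b b' : ℕ} {c : ℤ}
    (hb : 1 ≤ b) (hb' : 1 ≤ b') (h : bead e s Λ b c = bead e s Λ b' c) : b = b' := by
  rcases lt_trichotomy b b' with hlt | heq | hlt
  · have := bead_lt_bead e s Λ c hb hlt
    omega
  · exact heq
  · have := bead_lt_bead e s Λ c hb' hlt
    omega

/-- The letter `p` of the `t`-word sits in the extended row `c`. -/
def LetterAt (e : ℕ) (s : Fin (l + 1) → ℤ) (Λ : MultiPartition l) (t c : ℤ)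
    (p : Node l × Letter) : Prop :=
  p.1.comp = rowComp l c ∧ content s p.1 + rowLevel l c * e = t ∧
    ((p.2 = Letter.A ∧ Addable Λ p.1) ∨ (p.2 = Letter.R ∧ Removable Λ p.1))

theorem letterAt_A_iff (e : ℕ) (s : Fin (l + 1) → ℤ) (Λ : MultiPartition l) (t c : ℤ)
    (γ : Node l) : LetterAt e s Λ t c (γ, Letter.A) ↔
      γ.comp = rowComp l c ∧ γ.row = colLength (Λ (rowComp l c)) γ.col + 1 ∧ 1 ≤ γ.col ∧
        bead e s Λ γ.col c = t + 1 ∧ ∀ b, 1 ≤ b → bead e s Λ b c ≠ t := by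
  obtain ⟨a, b, r⟩ := γ
  simp only [LetterAt, addable_iff, reduceCtorEq, false_and, or_false, true_and]
  constructor
  · rintro ⟨rfl, h2, h3, h4, h5⟩
    have hbead : bead e s Λ b c = t + 1 := by
      simp only [content, bead, front, chargeExt] at h2 ⊢
      omega
    refine ⟨rfl, h4, h3, hbead, fun b' hb' heq => ?_⟩
    rcases lt_trichotomy b b' with hlt | rfl | hlt
    · have := bead_lt_bead e s Λ c h3 hlt
      omega
    · omega
    · have h6 : bead e s Λ (b - 1) c < t := by
        rcases h5 with h5 | h5
        · omega
        · simp only [bead, front] at hbead ⊢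
          omega
      have : bead e s Λ b' c ≤ bead e s Λ (b - 1) c := by
        rcases eq_or_lt_of_le (show b' ≤ b - 1 by omega) with h | h
        · rw [h]
        · exact (bead_lt_bead e s Λ c hb' h).le
      omega
  · rintro ⟨rfl, h4, h3, h2, h5⟩
    refine ⟨rfl, ?_, h3, h4, ?_⟩
    · simp only [content, bead, front, chargeExt] at h2 ⊢
      omega
    · by_cases hb : b = 1
      · exact Or.inl hb
      · right
        have h6 := h5 (b - 1) (by omega)
        have h7 := colLength_anti (Λ (rowComp l c)) (v := b - 1) (w := b) (by omega) (by omega)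
        simp only [bead, front] at h2 h6
        omega

theorem letterAt_R_iff (e : ℕ) (s : Fin (l + 1) → ℤ) (Λ : MultiPartition l) (t c : ℤ)
    (γ : Node l) : LetterAt e s Λ t c (γ, Letter.R) ↔
      γ.comp = rowComp l c ∧ γ.row = colLength (Λ (rowComp l c)) γ.col ∧ 1 ≤ γ.col ∧
        bead e s Λ γ.col c = t ∧ ∀ b, 1 ≤ b → bead e s Λ b c ≠ t + 1 := by
  obtain ⟨a, b, r⟩ := γ
  simp only [LetterAt, removable_iff, reduceCtorEq, false_and, false_or, true_and]
  constructor
  · rintro ⟨rfl, h2, h3, h4, h5⟩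
    have hbead : bead e s Λ b c = t := by
      simp only [content, bead, front, chargeExt] at h2 ⊢
      omega
    refine ⟨rfl, h4, h3, hbead, fun b' hb' heq => ?_⟩
    rcases lt_trichotomy b b' with hlt | rfl | hlt
    · have h6 : t + 1 < bead e s Λ (b + 1) c := by
        simp only [bead, front] at hbead ⊢
        push_cast
        omega
      have : bead e s Λ (b + 1) c ≤ bead e s Λ b' c := by
        rcases eq_or_lt_of_le (show b + 1 ≤ b' by omega) with h | h
        · rw [h]
        · exact (bead_lt_bead e s Λ c (by omega) h).le
      omega
    · omega
    · have := bead_lt_bead e s Λ c hb' hlt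
      omega
  · rintro ⟨rfl, h4, h3, h2, h5⟩
    refine ⟨rfl, ?_, h3, h4, ?_⟩
    · simp only [content, bead, front, chargeExt] at h2 ⊢
      omega
    · have h6 := h5 (b + 1) (by omega)
      have h7 := colLength_anti (Λ (rowComp l c)) (v := b) (w := b + 1) (by omega) (by omega)
      simp only [bead, front] at h2 h6
      push_cast at h6
      omega

theorem LetterAt.unique {e : ℕ} {s : Fin (l + 1) → ℤ} {Λ : MultiPartition l} {t c : ℤ}
    {p q : Node l × Letter} (hp : LetterAt e s Λ t c p) (hq : LetterAt e s Λ t c q) : p = q := by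
  obtain ⟨γ, x⟩ := p
  obtain ⟨δ, y⟩ := q
  cases x <;> cases y
  · obtain ⟨h1, h2, h3, h4, -⟩ := (letterAt_A_iff ..).1 hp
    obtain ⟨h1', h2', h3', h4', -⟩ := (letterAt_A_iff ..).1 hq
    have h5 := bead_inj h3 h3' (h4.trans h4'.symm)
    obtain ⟨a, b, r⟩ := γ
    obtain ⟨a', b', r'⟩ := δ
    simp_all
  · obtain ⟨h1, h2, h3, h4, h5⟩ := (letterAt_A_iff ..).1 hp
    obtain ⟨h1', h2', h3', h4', -⟩ := (letterAt_R_iff ..).1 hq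
    exact absurd h4' (h5 _ h3')
  · obtain ⟨h1, h2, h3, h4, h5⟩ := (letterAt_R_iff ..).1 hp
    obtain ⟨h1', h2', h3', h4', -⟩ := (letterAt_A_iff ..).1 hq
    exact absurd h4' (h5 _ h3')
  · obtain ⟨h1, h2, h3, h4, -⟩ := (letterAt_R_iff ..).1 hp
    obtain ⟨h1', h2', h3', h4', -⟩ := (letterAt_R_iff ..).1 hq
    have h5 := bead_inj h3 h3' (h4.trans h4'.symm)
    obtain ⟨a, b, r⟩ := γ
    obtain ⟨a', b', r'⟩ := δ
    simp_all

theorem LetterAt.nodeLt {e : ℕ} {s : Fin (l + 1) → ℤ} {Λ : MultiPartition l} {t c d : ℤ}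
    {p q : Node l × Letter} (hp : LetterAt e s Λ t c p) (hq : LetterAt e s Λ t d q)
    (he : 0 < e) (hcd : d < c) : NodeLt s p.1 q.1 := by
  obtain ⟨h1, h2, -⟩ := hp
  obtain ⟨h3, h4, -⟩ := hq
  have h5 := rowComp_add_rowLevel l c
  have h6 := rowComp_add_rowLevel l d
  have h7 := (rowComp l c).isLt
  have h8 := (rowComp l d).isLt
  rcases lt_trichotomy (rowLevel l d) (rowLevel l c) with h | h | h
  · left
    have : (rowLevel l d + 1) * (e : ℤ) ≤ rowLevel l c * e := by gcongr; omega
    rw [add_mul] at this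
    omega
  · right
    rw [h] at h4 h6
    refine ⟨by omega, ?_⟩
    rw [h1, h3, Fin.lt_def]
    omega
  · exfalso
    have : ((l : ℤ) + 1) * (rowLevel l c + 1) ≤ ((l : ℤ) + 1) * rowLevel l d := by gcongr; omega
    rw [mul_add] at this
    omega

open Classical in
/-- The letter in row `c` of the `t`-word, if any. -/
noncomputable def rowLetter (e : ℕ) (s : Fin (l + 1) → ℤ) (Λ : MultiPartition l) (t c : ℤ) :
    Option (Node l × Letter) :=
  if h : ∃ p, LetterAt e s Λ t c p then some h.choose else none

theorem rowLetter_eq_some_iff {e : ℕ} {s : Fin (l + 1) → ℤ} {Λ : MultiPartition l} {t c : ℤ}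
    {p : Node l × Letter} : rowLetter e s Λ t c = some p ↔ LetterAt e s Λ t c p := by
  rw [rowLetter]
  split_ifs with h
  · rw [Option.some.injEq]
    exact ⟨fun hp => hp ▸ h.choose_spec, fun hp => h.choose_spec.unique hp⟩
  · exact ⟨fun hp => by simp at hp, fun hp => (h ⟨p, hp⟩).elim⟩

open Classical in
/-- The number (`0` or `1`) of beads with index in `S` at position `t` of row `c`. -/
noncomputable def beadCount (e : ℕ) (s : Fin (l + 1) → ℤ) (Λ : MultiPartition l) (S : Set ℕ)
    (t c : ℤ) : ℤ :=
  if ∃ b, 1 ≤ b ∧ b ∈ S ∧ bead e s Λ b c = t then 1 else 0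

theorem beadCount_eq_one {e : ℕ} {s : Fin (l + 1) → ℤ} {Λ : MultiPartition l} {S : Set ℕ}
    {t c : ℤ} {b : ℕ} (hb : 1 ≤ b) (hS : b ∈ S) (h : bead e s Λ b c = t) :
    beadCount e s Λ S t c = 1 := if_pos ⟨b, hb, hS, h⟩

theorem beadCount_eq_zero {e : ℕ} {s : Fin (l + 1) → ℤ} {Λ : MultiPartition l} {S : Set ℕ}
    {t c : ℤ} (h : ∀ b, 1 ≤ b → b ∈ S → bead e s Λ b c ≠ t) :
    beadCount e s Λ S t c = 0 := if_neg (fun ⟨b, hb, hS, hbt⟩ => h b hb hS hbt)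

theorem beadCount_univ (e : ℕ) (s : Fin (l + 1) → ℤ) (Λ : MultiPartition l) (S : Set ℕ)
    (t c : ℤ) : beadCount e s Λ Set.univ t c = beadCount e s Λ S t c + beadCount e s Λ Sᶜ t c := by
  by_cases h : ∃ b, 1 ≤ b ∧ bead e s Λ b c = t
  · obtain ⟨b, hb, hbt⟩ := h
    rw [beadCount_eq_one hb (Set.mem_univ b) hbt]
    by_cases hS : b ∈ S
    · rw [beadCount_eq_one hb hS hbt, beadCount_eq_zero]
      · rfl
      · intro b' hb' hS' hbt'
        exact hS' (bead_inj hb hb' (hbt.trans hbt'.symm) ▸ hS)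
    · rw [beadCount_eq_one (S := Sᶜ) hb hS hbt, beadCount_eq_zero]
      · rfl
      · intro b' hb' hS' hbt'
        exact hS (bead_inj hb hb' (hbt.trans hbt'.symm) ▸ hS')
  · push Not at h
    rw [beadCount_eq_zero (fun b hb _ => h b hb), beadCount_eq_zero (fun b hb _ => h b hb),
      beadCount_eq_zero (fun b hb _ => h b hb)]
    rfl

/-- The contribution of the beads with index in `S` to the weight of row `c` in the `t`-word. -/
noncomputable def beadWeight (e : ℕ) (s : Fin (l + 1) → ℤ) (Λ : MultiPartition l) (S : Set ℕ)
    (t c : ℤ) : ℤ :=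
  beadCount e s Λ S (t + 1) c - beadCount e s Λ S t c

theorem beadWeight_univ (e : ℕ) (s : Fin (l + 1) → ℤ) (Λ : MultiPartition l) (S : Set ℕ)
    (t c : ℤ) :
    beadWeight e s Λ Set.univ t c = beadWeight e s Λ S t c + beadWeight e s Λ Sᶜ t c := by
  simp only [beadWeight, beadCount_univ e s Λ S]
  ring

theorem letterWeight_rowLetter (e : ℕ) (s : Fin (l + 1) → ℤ) (Λ : MultiPartition l) (t c : ℤ) :
    letterWeight (rowLetter e s Λ t c) = beadWeight e s Λ Set.univ t c := by
  rw [beadWeight]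
  cases h : rowLetter e s Λ t c with
  | some p =>
    obtain ⟨γ, x⟩ := p
    rw [rowLetter_eq_some_iff] at h
    cases x with
    | A =>
      obtain ⟨-, -, h3, h4, h5⟩ := (letterAt_A_iff ..).1 h
      rw [beadCount_eq_one h3 (Set.mem_univ _) h4, beadCount_eq_zero (fun b hb _ => h5 b hb)]
      rfl
    | R =>
      obtain ⟨-, -, h3, h4, h5⟩ := (letterAt_R_iff ..).1 h
      rw [beadCount_eq_one h3 (Set.mem_univ _) h4, beadCount_eq_zero (fun b hb _ => h5 b hb)]
      rfl
  | none =>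
    have hno : ∀ p, ¬ LetterAt e s Λ t c p := fun p hp => by
      rw [rowLetter_eq_some_iff.2 hp] at h
      simp at h
    simp only [letterWeight]
    by_cases h1 : ∃ b, 1 ≤ b ∧ bead e s Λ b c = t + 1 <;>
      by_cases h2 : ∃ b, 1 ≤ b ∧ bead e s Λ b c = t
    · obtain ⟨b, hb, hbt⟩ := h1
      obtain ⟨b', hb', hbt'⟩ := h2
      rw [beadCount_eq_one hb (Set.mem_univ _) hbt, beadCount_eq_one hb' (Set.mem_univ _) hbt']
      rfl
    · obtain ⟨b, hb, hbt⟩ := h1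
      push Not at h2
      exact (hno (⟨colLength (Λ (rowComp l c)) b + 1, b, rowComp l c⟩, Letter.A) ((letterAt_A_iff ..).2 ⟨rfl, rfl, hb, hbt, h2⟩)).elim
    · obtain ⟨b, hb, hbt⟩ := h2
      push Not at h1
      exact (hno (⟨colLength (Λ (rowComp l c)) b, b, rowComp l c⟩, Letter.R) ((letterAt_R_iff ..).2 ⟨rfl, rfl, hb, hbt, h1⟩)).elim
    · push Not at h1 h2
      rw [beadCount_eq_zero (fun b hb _ => h1 b hb), beadCount_eq_zero (fun b hb _ => h2 b hb)]
      rfl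

theorem exists_letterAt_A {e : ℕ} {s : Fin (l + 1) → ℤ} {Λ : MultiPartition l} {t c : ℤ}
    (h : beadWeight e s Λ Set.univ t c = 1) : ∃ γ, LetterAt e s Λ t c (γ, Letter.A) := by
  rw [← letterWeight_rowLetter] at h
  cases ho : rowLetter e s Λ t c with
  | none => simp [ho, letterWeight] at h
  | some p =>
    obtain ⟨γ, x⟩ := p
    cases x with
    | A => exact ⟨γ, rowLetter_eq_some_iff.1 ho⟩
    | R => simp [ho, letterWeight] at h

theorem LetterAt.beadWeight_ne_zero {e : ℕ} {s : Fin (l + 1) → ℤ} {Λ : MultiPartition l}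
    {t c : ℤ} {p : Node l × Letter} (h : LetterAt e s Λ t c p) :
    beadWeight e s Λ Set.univ t c ≠ 0 := by
  rw [← letterWeight_rowLetter, rowLetter_eq_some_iff.2 h]
  obtain ⟨γ, x⟩ := p
  cases x <;> simp [letterWeight]

theorem exists_chargeExt_bound {e : ℕ} (he : 0 < e) (s : Fin (l + 1) → ℤ) (B : ℤ) :
    ∃ M, (∀ c, M ≤ c → B < chargeExt e s c) ∧ ∀ c, c ≤ -M → chargeExt e s c < -B := by
  obtain ⟨K, hK0, hK⟩ : ∃ K : ℤ, 0 ≤ K ∧ ∀ r, |s r| ≤ K :=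
    ⟨∑ r, |s r|, Finset.sum_nonneg fun _ _ => abs_nonneg _,
      fun r => Finset.single_le_sum (f := fun r => |s r|) (fun _ _ => abs_nonneg _)
        (Finset.mem_univ r)⟩
  refine ⟨((l : ℤ) + 1) * (|B| + K + 2), fun c hc => ?_, fun c hc => ?_⟩ <;>
  · have h1 := rowComp_add_rowLevel l c
    have h2 := (rowComp l c).isLt
    have h3 := abs_le.1 (hK (rowComp l c))
    have h4 := le_abs_self B
    have h5 := abs_nonneg B
    rw [chargeExt]
    set k := rowLevel l c
    first
    | have h6 : |B| + K + 1 ≤ k := by nlinarith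
      nlinarith
    | have h6 : k ≤ -(|B| + K + 1) := by nlinarith
      nlinarith

theorem exists_beadWeight_eq_zero {e : ℕ} (he : 0 < e) (s : Fin (l + 1) → ℤ)
    (Λ : MultiPartition l) (t : ℤ) :
    ∃ M, 0 ≤ M ∧ (∀ c, M ≤ c → beadWeight e s Λ Set.univ t c = 0) ∧
      ∀ c, c < -M → beadWeight e s Λ Set.univ t c = 0 := by
  choose V hV using fun r => colLength_eventually_zero (Λ r)
  obtain ⟨K, hK⟩ : ∃ K : ℕ, ∀ r, V r + colLength (Λ r) 1 ≤ K :=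
    ⟨∑ r, (V r + colLength (Λ r) 1),
      fun r => Finset.single_le_sum (f := fun r => V r + colLength (Λ r) 1)
        (fun _ _ => Nat.zero_le _) (Finset.mem_univ r)⟩
  obtain ⟨M, hM1, hM2⟩ := exists_chargeExt_bound he s (|t| + K + 1)
  have ht := le_abs_self t
  have ht' := neg_abs_le t
  have ht0 := abs_nonneg t
  refine ⟨max M 0, le_max_right _ _, fun c hc => ?_, fun c hc => ?_⟩
  · have h1 := hM1 c (by omega)
    have h2 := hK (rowComp l c)
    have h3 : ∀ b, 1 ≤ b → t + 1 < bead e s Λ b c := fun b hb => by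
      have := colLength_anti (Λ (rowComp l c)) le_rfl hb
      simp only [bead, front]
      omega
    rw [beadWeight, beadCount_eq_zero fun b hb _ => (h3 b hb).ne',
      beadCount_eq_zero fun b hb _ => by have := h3 b hb; omega]
    rfl
  · have h1 := hM2 c (by omega)
    have h2 := hK (rowComp l c)
    have h3 : ∀ u, t ≤ u → ∃ b, 1 ≤ b ∧ b ∈ Set.univ ∧ bead e s Λ b c = u := fun u hu => by
      refine ⟨(u - chargeExt e s c).toNat, by omega, trivial, ?_⟩
      have h4 := hV (rowComp l c) (u - chargeExt e s c).toNat (by omega)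
      simp only [bead, front, h4]
      omega
    obtain ⟨b, hb, hS, hbt⟩ := h3 t le_rfl
    obtain ⟨b', hb', hS', hbt'⟩ := h3 (t + 1) (by omega)
    rw [beadWeight, beadCount_eq_one hb hS hbt, beadCount_eq_one hb' hS' hbt']
    rfl

theorem mem_rowWord {β : Type*} (o : ℤ → Option β) (m : ℤ) (n : ℕ) (x : β) :
    x ∈ rowWord o m n ↔ ∃ c, m ≤ c ∧ c < m + n ∧ o c = some x := by
  induction n with
  | zero =>
    simp only [rowWord, List.not_mem_nil, false_iff, not_exists]
    push_cast
    intro c h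
    omega
  | succ n ih =>
    rw [rowWord, List.mem_append, ih, Option.mem_toList]
    push_cast
    constructor
    · rintro (h | ⟨c, h1, h2, h3⟩)
      · exact ⟨m + n, by omega, by omega, h⟩
      · exact ⟨c, h1, by omega, h3⟩
    · rintro ⟨c, h1, h2, h3⟩
      rcases eq_or_ne c (m + n) with rfl | h
      · exact Or.inl h3
      · exact Or.inr ⟨c, h1, by omega, h3⟩

theorem pairwise_rowWord {β : Type*} (o : ℤ → Option β) (m : ℤ) (n : ℕ) {r : β → β → Prop}
    (h : ∀ c d x y, d < c → o c = some x → o d = some y → r x y) :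
    (rowWord o m n).Pairwise r := by
  induction n with
  | zero => exact List.Pairwise.nil
  | succ n ih =>
    rw [rowWord, List.pairwise_append]
    refine ⟨?_, ih, fun x hx y hy => ?_⟩
    · cases o (m + n) <;> simp
    · rw [Option.mem_toList] at hx
      obtain ⟨c, -, hc, hy⟩ := (mem_rowWord ..).1 hy
      exact h _ _ _ _ hc hx hy

theorem isWordE_rowWord {e : ℕ} (he : 0 < e) (s : Fin (l + 1) → ℤ) (Λ : MultiPartition l)
    {i m : ℤ} {n : ℕ} (hi : 0 ≤ i) (hie : i < e)
    (hlo : ∀ c, c < m → beadWeight e s Λ Set.univ i c = 0)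
    (hhi : ∀ c, m + n ≤ c → beadWeight e s Λ Set.univ i c = 0) :
    IsWordE Λ s e i (rowWord (rowLetter e s Λ i) m n) := by
  refine ⟨pairwise_rowWord _ _ _ fun c d x y hcd hx hy => ?_, fun γ => ⟨?_, ?_⟩, ?_⟩
  · exact (rowLetter_eq_some_iff.1 hx).nodeLt (rowLetter_eq_some_iff.1 hy) he hcd
  · rintro ⟨x, hx⟩
    obtain ⟨c, -, -, hc⟩ := (mem_rowWord ..).1 hx
    obtain ⟨-, h2, h3⟩ := rowLetter_eq_some_iff.1 hc
    refine ⟨h3.imp And.right And.right, ?_⟩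
    rw [← Int.emod_eq_of_lt hi hie, ← h2]
    simp
  · rintro ⟨h1, h2⟩
    obtain ⟨h3, h4⟩ := row_decomp l γ.comp (-(content s γ / e))
    set c : ℤ := (γ.comp : ℕ) + ((l : ℤ) + 1) * (-(content s γ / e))
    obtain ⟨x, hx⟩ : ∃ x, LetterAt e s Λ i c (γ, x) := by
      have h5 : content s γ + rowLevel l c * e = i := by
        rw [h4]
        have := Int.emod_add_mul_ediv (content s γ) e
        rw [h2] at this
        linarith
      rcases h1 with h1 | h1
      · exact ⟨Letter.A, h3.symm, h5, Or.inl ⟨rfl, h1⟩⟩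
      · exact ⟨Letter.R, h3.symm, h5, Or.inr ⟨rfl, h1⟩⟩
    refine ⟨x, (mem_rowWord ..).2 ⟨c, ?_, ?_, rowLetter_eq_some_iff.2 hx⟩⟩
    · by_contra h
      exact hx.beadWeight_ne_zero (hlo c (by omega))
    · by_contra h
      exact hx.beadWeight_ne_zero (hhi c (by omega))
  · rintro ⟨γ, x⟩ hp
    obtain ⟨c, -, -, hc⟩ := (mem_rowWord ..).1 hp
    obtain ⟨-, -, ⟨h1, h3⟩ | ⟨h1, h3⟩⟩ := rowLetter_eq_some_iff.1 hc
    · simp only at h1 h3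
      subst h1
      exact ⟨by simp [h3], by simp; exact fun h => not_addable_of_removable h h3⟩
    · simp only at h1 h3
      subst h1
      exact ⟨by simp; exact not_addable_of_removable h3, by simp [h3]⟩

theorem NodeLt.asymm {s : Fin (l + 1) → ℤ} {γ δ : Node l} (h : NodeLt s γ δ) :
    ¬ NodeLt s δ γ := by
  rcases h with h | ⟨h, h'⟩ <;> rintro (h2 | ⟨h2, h2'⟩)
  · omega
  · omega
  · omega
  · exact h'.asymm h2'

theorem IsWordE.unique {Λ : MultiPartition l} {s : Fin (l + 1) → ℤ} {e : ℕ} {i : ℤ}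
    {w w' : List (Node l × Letter)} (hw : IsWordE Λ s e i w) (hw' : IsWordE Λ s e i w') :
    w = w' := by
  have hsub : ∀ {w w'}, IsWordE Λ s e i w → IsWordE Λ s e i w' → ∀ p ∈ w, p ∈ w' := by
    rintro w w' hw hw' ⟨γ, x⟩ hp
    obtain ⟨y, hy⟩ := (hw'.2.1 γ).2 ((hw.2.1 γ).1 ⟨x, hp⟩)
    obtain ⟨h1, h2⟩ := hw.2.2 _ hp
    obtain ⟨h3, h4⟩ := hw'.2.2 _ hy
    have : x = y := by
      cases x <;> cases y <;> simp_all
    rwa [this]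
  have hnd : ∀ {w}, IsWordE Λ s e i w → w.Nodup := fun hw =>
    hw.1.imp fun {a b} hab hEq => by
      subst hEq
      exact hab.asymm hab
  refine List.Perm.eq_of_pairwise ?_ hw.1 hw'.1
    ((List.perm_ext_iff_of_nodup (hnd hw) (hnd hw')).2
      fun p => ⟨hsub hw hw' p, hsub hw' hw p⟩)
  intro a b _ _ hab hba
  exact (hab.asymm hba).elim

theorem goodAddable_iff {e : ℕ} (he : 0 < e) (s : Fin (l + 1) → ℤ) (Λ : MultiPartition l)
    {i : ℤ} (hi : 0 ≤ i) (hie : i < e) {G : ℤ → ℤ}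
    (hG : ∀ c, G (c + 1) = G c + beadWeight e s Λ Set.univ i c) (γ : Node l) :
    GoodAddable Λ s e i γ ↔ ∃ c, LastMin G c ∧ LetterAt e s Λ i c (γ, Letter.A) := by
  obtain ⟨M, hM0, hM1, hM2⟩ := exists_beadWeight_eq_zero he s Λ i
  have hn : -M + ((2 * M).toNat : ℤ) = M := by omega
  have hword := isWordE_rowWord (m := -M) (n := (2 * M).toNat) he s Λ hi hie hM2
    (fun c hc => hM1 c (by omega))
  have hlo : ∀ c, c ≤ -M → G c = G (-M) := by
    intro c hc
    induction c, hc using Int.leInductionDown with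
    | base => rfl
    | pred c hc ih =>
      have h1 := hG (c - 1)
      have h2 := hM2 (c - 1) (by omega)
      rw [sub_add_cancel] at h1
      omega
  have hhi : ∀ c, -M + ((2 * M).toNat : ℤ) ≤ c → G c = G (-M + ((2 * M).toNat : ℤ)) := by
    intro c hc
    induction c, hc using Int.leInduction with
    | base => rfl
    | succ c hc ih =>
      have h1 := hG c
      have h2 := hM1 c (by omega)
      omega
  have key := goodAddableWord_rowWord_iff (rowLetter e s Λ i) (-M) (2 * M).toNat G
    (fun c => by rw [letterWeight_rowLetter]; exact hG c) hlo hhi γ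
  simp only [rowLetter_eq_some_iff] at key
  rw [← key]
  constructor
  · rintro ⟨w, hw, h⟩
    rwa [← hw.unique hword]
  · exact fun h => ⟨_, hword, h⟩

theorem front_coe (e : ℕ) (s : Fin (l + 1) → ℤ) (Λ : MultiPartition l) (v : ℕ)
    (r : Fin (l + 1)) : front e s Λ v (r : ℕ) = s r - colLength (Λ r) v := by
  rw [front, chargeExt, rowComp_coe, rowLevel_coe]
  ring

/-- The nodes of parts of size `α` at the `e` largest positions, each in the smallest possible
component. -/
theorem exists_topNodes {e : ℕ} (he : 0 < e) {s : Fin (l + 1) → ℤ} {Λ : MultiPartition l}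
    (hmono : ∀ v, 1 ≤ v → Monotone (front e s Λ v)) {α : ℕ} (hα : 1 ≤ α)
    (hcov : ∀ c, front e s Λ α (c + 1) ≤ front e s Λ (α + 1) c) :
    ∃ P : ℕ → Node l, ∀ i, i < e → RightmostAt Λ α (P i) ∧
      content s (P i) = α + (front e s Λ (α + 1) l - 1 - i) ∧
      ∀ C : Fin (l + 1), (P i).comp = C ↔
        front e s Λ (α + 1) ((C : ℕ) - 1) ≤ front e s Λ (α + 1) l - 1 - i ∧
          front e s Λ (α + 1) l - 1 - i < front e s Λ (α + 1) (C : ℕ) := by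
  suffices h : ∀ i : ℕ, ∃ γ : Node l, i < e → RightmostAt Λ α γ ∧
      content s γ = α + (front e s Λ (α + 1) l - 1 - i) ∧
      ∀ C : Fin (l + 1), γ.comp = C ↔
        front e s Λ (α + 1) ((C : ℕ) - 1) ≤ front e s Λ (α + 1) l - 1 - i ∧
          front e s Λ (α + 1) l - 1 - i < front e s Λ (α + 1) (C : ℕ) by
    choose P hP using h
    exact ⟨P, hP⟩
  intro i
  by_cases hi : i < e
  swap
  · exact ⟨⟨0, 0, 0⟩, fun h => absurd h hi⟩
  set j := front e s Λ (α + 1) l - 1 - i with hj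
  obtain ⟨q, hq⟩ := exists_front_threshold he (hmono (α + 1) (by omega)) j
  have hturn := front_turn e s Λ (α + 1) (-1)
  rw [show (-1 : ℤ) + ((l : ℤ) + 1) = l by ring] at hturn
  have h1 : -1 ≤ q := (hq (-1)).1 (by omega)
  have h2 : q < l := by
    by_contra h
    have := (hq l).2 (by omega)
    omega
  obtain ⟨r, hr⟩ : ∃ r : Fin (l + 1), ((r : ℕ) : ℤ) = q + 1 :=
    ⟨⟨(q + 1).toNat, by omega⟩, by simp only; omega⟩
  have h3 := (hq q).2 le_rfl
  have h4 := mt (hq (q + 1)).1 (by omega)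
  have h5 := hcov q
  rw [← hr, front_coe] at h4 h5
  refine ⟨⟨(s r - j).toNat, α, r⟩, fun _ => ⟨?_, ?_, fun C => ?_⟩⟩
  · rw [rightmostAt_iff Λ hα]
    simp only [true_and]
    constructor <;> omega
  · simp only [content]
    omega
  · have h6 := hq ((C : ℕ) - 1)
    have h7 := hq (C : ℕ)
    rw [h6, ← not_le, h7]
    simp only [Fin.ext_iff]
    omega

theorem isFirstPseudoperiod_topNodes {e : ℕ} (he : 0 < e) {s : Fin (l + 1) → ℤ}
    {Λ : MultiPartition l} (hmono : ∀ v, 1 ≤ v → Monotone (front e s Λ v)) {α : ℕ} (hα : 1 ≤ α)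
    (hcov : Covers e s Λ α) (hmax : ∀ β, α < β → ¬ Covers e s Λ β) {P : ℕ → Node l}
    (hP : ∀ i, i < e → RightmostAt Λ α (P i) ∧
      content s (P i) = α + (front e s Λ (α + 1) l - 1 - i) ∧
      ∀ C : Fin (l + 1), (P i).comp = C ↔
        front e s Λ (α + 1) ((C : ℕ) - 1) ≤ front e s Λ (α + 1) l - 1 - i ∧
          front e s Λ (α + 1) l - 1 - i < front e s Λ (α + 1) (C : ℕ)) :
    IsFirstPseudoperiod e s Λ α P := by
  have hpos : ∀ γ, RightmostAt Λ α γ →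
      content s γ < α + front e s Λ (α + 1) (γ.comp : ℕ) := by
    intro γ hγ
    obtain ⟨h1, h2, -⟩ := (rightmostAt_iff Λ hα γ).1 hγ
    rw [front_coe]
    simp only [content]
    omega
  have hcomp : ∀ i, i < e → ∀ γ, RightmostAt Λ α γ → content s γ = content s (P i) →
      (P i).comp ≤ γ.comp := by
    intro i hi γ hγ hc
    obtain ⟨-, h2, h3⟩ := hP i hi
    have h4 := ((h3 _).1 rfl).1
    have h5 := hpos γ hγ
    by_contra hlt
    rw [Fin.le_def, not_le] at hlt
    have := hmono (α + 1) (by omega) (show ((γ.comp : ℕ) : ℤ) ≤ ((P i).comp : ℕ) - 1 by omega)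
    omega
  refine ⟨hα, hcov, hmax, fun i hi => (hP i hi).1, fun γ hγ => ?_, hcomp 0 he, fun i hi => ?_⟩
  · have h1 := hpos γ hγ
    have h2 := (hP 0 he).2.1
    have h3 := γ.comp.isLt
    have := hmono (α + 1) (by omega) (show ((γ.comp : ℕ) : ℤ) ≤ l by omega)
    push_cast at h2
    omega
  · have h1 := (hP i (by omega)).2.1
    have h2 := (hP (i + 1) hi).2.1
    push_cast at h2
    refine ⟨by omega, fun γ _ hlt => by omega, hcomp _ hi⟩

theorem RightmostAt.ext {s : Fin (l + 1) → ℤ} {Λ : MultiPartition l} {α : ℕ} {γ δ : Node l}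
    (hγ : RightmostAt Λ α γ) (hδ : RightmostAt Λ α δ) (hc : content s γ = content s δ)
    (hcomp : γ.comp = δ.comp) : γ = δ := by
  obtain ⟨-, h1, -⟩ := hγ
  obtain ⟨-, h2, -⟩ := hδ
  obtain ⟨a, b, c⟩ := γ
  obtain ⟨a', b', c'⟩ := δ
  simp only [content] at h1 h2 hc hcomp
  subst hcomp h1 h2
  simp only [Node.mk.injEq, and_true]
  omega

theorem IsFirstPseudoperiod.unique {e : ℕ} {s : Fin (l + 1) → ℤ} {Λ : MultiPartition l} {α : ℕ}
    {P Q : ℕ → Node l} (hP : IsFirstPseudoperiod e s Λ α P)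
    (hQ : IsFirstPseudoperiod e s Λ α Q) : ∀ i, i < e → P i = Q i := by
  obtain ⟨-, -, -, hP1, hP2, hP3, hP4⟩ := hP
  obtain ⟨-, -, -, hQ1, hQ2, hQ3, hQ4⟩ := hQ
  intro i
  induction i with
  | zero =>
    intro h0
    have hc : content s (P 0) = content s (Q 0) :=
      le_antisymm (hQ2 _ (hP1 0 h0)) (hP2 _ (hQ1 0 h0))
    exact (hP1 0 h0).ext (hQ1 0 h0) hc
      (le_antisymm (hP3 _ (hQ1 0 h0) hc.symm) (hQ3 _ (hP1 0 h0) hc))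
  | succ i ih =>
    intro hi
    have hi' := ih (by omega)
    obtain ⟨p1, p2, p3⟩ := hP4 i hi
    obtain ⟨q1, q2, q3⟩ := hQ4 i hi
    have hc : content s (P (i + 1)) = content s (Q (i + 1)) :=
      le_antisymm (q2 _ (hP1 _ hi) (by rw [← hi']; exact p1))
        (p2 _ (hQ1 _ hi) (by rw [hi']; exact q1))
    exact (hP1 _ hi).ext (hQ1 _ hi) hc
      (le_antisymm (p3 _ (hQ1 _ hi) hc.symm) (q3 _ (hP1 _ hi) hc))

theorem nalP_eq {e : ℕ} (he : 0 < e) {s : Fin (l + 1) → ℤ} {Λ : MultiPartition l}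
    (hmono : ∀ v, 1 ≤ v → Monotone (front e s Λ v)) {α : ℕ} {P : ℕ → Node l}
    (hP : IsFirstPseudoperiod e s Λ α P) (C : Fin (l + 1)) :
    (NalP e P C : ℤ) = front e s Λ (α + 1) (C : ℕ) - front e s Λ (α + 1) ((C : ℕ) - 1) := by
  have hα := hP.1
  obtain ⟨Q, hQ⟩ := exists_topNodes he hmono hα ((covers_iff he hmono hα).1 hP.2.1)
  have hPQ := hP.unique (isFirstPseudoperiod_topNodes he hmono hα hP.2.1 hP.2.2.1 hQ)
  have hC := C.isLt
  have h1 := hmono (α + 1) (by omega) (show ((C : ℕ) : ℤ) - 1 ≤ (C : ℕ) by omega)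
  have h2 := hmono (α + 1) (by omega) (show ((C : ℕ) : ℤ) ≤ l by omega)
  have h3 := hmono (α + 1) (by omega) (show (-1 : ℤ) ≤ (C : ℕ) - 1 by omega)
  have hturn := front_turn e s Λ (α + 1) (-1)
  rw [show (-1 : ℤ) + ((l : ℤ) + 1) = l by ring] at hturn
  rw [NalP, Nat.subtype_card (Finset.Ico
    (front e s Λ (α + 1) l - front e s Λ (α + 1) (C : ℕ)).toNat
    (front e s Λ (α + 1) l - front e s Λ (α + 1) ((C : ℕ) - 1)).toNat), Nat.card_Ico]
  · omega
  · intro i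
    rw [Finset.mem_Ico]
    constructor
    · intro h
      have hi : i < e := by omega
      refine ⟨hi, ?_⟩
      rw [hPQ i hi, (hQ i hi).2.2 C]
      omega
    · rintro ⟨hi, h⟩
      rw [hPQ i hi, (hQ i hi).2.2 C] at h
      omega

theorem eq_of_sub_succ_eq {f g : ℕ → ℤ} (hf : ∃ V, ∀ v, V ≤ v → f v = 0)
    (hg : ∃ V, ∀ v, V ≤ v → g v = 0) {n : ℕ}
    (h : ∀ v, n ≤ v → f v - f (v + 1) = g v - g (v + 1)) : ∀ v, n ≤ v → f v = g v := by
  obtain ⟨V, hV⟩ := hf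
  obtain ⟨W, hW⟩ := hg
  intro v hv
  by_cases hvn : v ≤ V + W
  · induction hvn using Nat.decreasingInduction with
    | self => rw [hV _ (by omega), hW _ (by omega)]
    | of_succ v _ ih =>
      have h1 := ih (by omega)
      have h2 := h v hv
      omega
  · rw [hV _ (by omega), hW _ (by omega)]

/-- In terms of fronts, the reduction shifts the fronts of index greater than `α` by one row. -/
theorem isPsi_iff {e : ℕ} (he : 0 < e) {s : Fin (l + 1) → ℤ} {Λ μ : MultiPartition l}
    (hmono : ∀ v, 1 ≤ v → Monotone (front e s Λ v)) {α : ℕ} {P : ℕ → Node l}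
    (hP : IsFirstPseudoperiod e s Λ α P) :
    IsPsi e P α Λ μ ↔ ∀ v, 1 ≤ v → ∀ c, front e (xiCharge e s) μ v c =
      if v ≤ α then front e s Λ v c else front e s Λ v (c - 1) := by
  have hα := hP.1
  have hcov := (covers_iff he hmono hα).1 hP.2.1
  have hanti : ∀ (π : Partition) {v w : ℕ}, 1 ≤ v → v ≤ w → (colLength π w : ℤ) ≤ colLength π v :=
    fun π v w hv hw => by exact_mod_cast colLength_anti π hv hw
  have hcount : ∀ (π : Partition) {v : ℕ}, 1 ≤ v →
      (countParts π v : ℤ) = colLength π v - colLength π (v + 1) := fun π v hv => by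
    rw [countParts_eq π hv]
    exact Nat.cast_sub (colLength_anti π hv (by omega))
  -- the number of removed parts, row by row
  have hN : ∀ c, (NalP e P (rowComp l c) : ℤ) =
      front e s Λ (α + 1) c - front e s Λ (α + 1) (c - 1) := by
    intro c
    have h1 := nalP_eq he hmono hP (rowComp l c)
    have h2 := front_turn_mul e s Λ (α + 1) (rowComp l c : ℕ) (rowLevel l c)
    have h3 := front_turn_mul e s Λ (α + 1) ((rowComp l c : ℕ) - 1) (rowLevel l c)
    rw [← rowComp_add_rowLevel] at h2
    rw [show (((rowComp l c : ℕ) : ℤ) - 1 + ((l : ℤ) + 1) * rowLevel l c) =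
      ((rowComp l c : ℕ) : ℤ) + ((l : ℤ) + 1) * rowLevel l c - 1 by ring,
      ← rowComp_add_rowLevel] at h3
    omega
  have hNle : ∀ c, NalP e P (rowComp l c) ≤ countParts (Λ (rowComp l c)) α := by
    intro c
    have h1 := hN c
    have h2 := hcov (c - 1)
    have h3 := hcount (Λ (rowComp l c)) hα
    rw [sub_add_cancel] at h2
    simp only [front] at h1 h2
    omega
  constructor
  · intro h v hv c
    simp only [IsPsi] at h
    have hhigh : ∀ v, α + 1 ≤ v →
        (colLength (μ (rowComp l c)) v : ℤ) = colLength (Λ (rowComp l (c - 1))) v := by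
      refine eq_of_sub_succ_eq ?_ ?_ fun v hv => ?_
      · obtain ⟨V, hV⟩ := colLength_eventually_zero (μ (rowComp l c))
        exact ⟨V, fun v hv => by simp [hV v hv]⟩
      · obtain ⟨V, hV⟩ := colLength_eventually_zero (Λ (rowComp l (c - 1)))
        exact ⟨V, fun v hv => by simp [hV v hv]⟩
      · have h1 := h (rowComp l c) v (by omega)
        rw [if_neg (by omega), if_neg (by omega), ← rowComp_pred] at h1
        rw [← hcount _ (by omega), ← hcount _ (by omega), h1]
    have hαα : (colLength (μ (rowComp l c)) α : ℤ) - colLength (μ (rowComp l c)) (α + 1) =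
        colLength (Λ (rowComp l c)) α - colLength (Λ (rowComp l c)) (α + 1) -
          NalP e P (rowComp l c) := by
      have h1 := h (rowComp l c) α hα
      rw [if_neg (by omega), if_pos rfl] at h1
      rw [← hcount _ hα, ← hcount _ hα, h1, Nat.cast_sub (hNle c)]
    have hh := hhigh (α + 1) le_rfl
    have hNc := hN c
    simp only [front] at hNc
    rw [front, chargeExt_xi]
    split_ifs with hvα
    · rw [front]
      induction hvα using Nat.decreasingInduction with
      | self => omega
      | of_succ v hvα ih =>
        have h1 := h (rowComp l c) v hv
        rw [if_pos hvα] at h1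
        have h2 := hcount (μ (rowComp l c)) hv
        have h3 := hcount (Λ (rowComp l c)) hv
        have h4 := ih (by omega)
        omega
    · rw [front, hhigh v (by omega)]
  · intro h C v hv
    have hCc : rowComp l ((C : ℕ) : ℤ) = C := rowComp_coe C
    generalize ((C : ℕ) : ℤ) = c at hCc
    subst hCc
    have h1 := h v hv c
    have h2 := h (v + 1) (by omega) c
    have h3 := hcount (μ (rowComp l c)) hv
    simp only [front, chargeExt_xi] at h1 h2
    split_ifs with hlt heq
    · have h4 := hcount (Λ (rowComp l c)) hv
      rw [if_pos (by omega)] at h1 h2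
      omega
    · subst heq
      have h4 := hcount (Λ (rowComp l c)) hv
      have h5 := hN c
      have h6 := hNle c
      rw [if_pos (by omega)] at h1
      rw [if_neg (by omega)] at h2
      simp only [front] at h5
      omega
    · rw [← rowComp_pred]
      have h4 := hcount (Λ (rowComp l (c - 1))) hv
      rw [if_neg (by omega)] at h1 h2
      omega

theorem exists_potential (f : ℤ → ℤ) : ∃ G : ℤ → ℤ, ∀ c, G (c + 1) = G c + f c := by
  refine ⟨fun c => ∑ i ∈ Finset.Ico 0 c, f i - ∑ i ∈ Finset.Ico c 0, f i, fun c => ?_⟩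
  rcases lt_or_ge c 0 with hc | hc
  · have h1 : Finset.Ico c 0 = insert c (Finset.Ico (c + 1) 0) := by
      ext x; simp only [Finset.mem_Ico, Finset.mem_insert]; omega
    have h2 : Finset.Ico 0 c = ∅ := Finset.Ico_eq_empty (by omega)
    have h3 : Finset.Ico 0 (c + 1) = ∅ := Finset.Ico_eq_empty (by omega)
    simp only [h1, h2, h3, Finset.sum_empty]
    rw [Finset.sum_insert (by simp)]
    ring
  · have h1 : Finset.Ico 0 (c + 1) = insert c (Finset.Ico 0 c) := by
      ext x; simp only [Finset.mem_Ico, Finset.mem_insert]; omega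
    have h2 : Finset.Ico c 0 = ∅ := Finset.Ico_eq_empty (by omega)
    have h3 : Finset.Ico (c + 1) 0 = ∅ := Finset.Ico_eq_empty (by omega)
    simp only [h1, h2, h3, Finset.sum_empty]
    rw [Finset.sum_insert (by simp)]
    ring

/-- Shifting by one step the part `Gh` of a potential `Gl + Gh` shifts the last minimum along,
when `Gl` decreases on `[p, q]` and is constant before, while `Gh` increases on `[p', q']` and is
constant afterwards. -/
theorem lastMin_shift {Gl Gh fl fh : ℤ → ℤ} (hGl : ∀ c, Gl (c + 1) = Gl c + fl c)
    (hGh : ∀ c, Gh (c + 1) = Gh c + fh c) {p q p' q' : ℤ} (hpq : p ≤ q + 1) (hpq' : p' ≤ q' + 1)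
    (hpp : p' < p) (hqq : q' < q) (hl0 : ∀ c, c < p → fl c = 0)
    (hl1 : ∀ c, p ≤ c → c ≤ q → fl c = -1) (hh0 : ∀ c, q' < c → fh c = 0)
    (hh1 : ∀ c, p' ≤ c → c ≤ q' → fh c = 1) {c₀ : ℤ} (h : LastMin (fun c => Gl c + Gh c) c₀) :
    (q + 1 ≤ c₀ ∧ LastMin (fun c => Gl c + Gh (c - 1)) c₀) ∨
      (c₀ ≤ p' ∧ LastMin (fun c => Gl c + Gh (c - 1)) (c₀ + 1) ∧ (p = p' + 1 → c₀ < p')) := by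
  have hL0 : ∀ c, c ≤ p → Gl c = Gl p := by
    intro c hc
    induction c, hc using Int.leInductionDown with
    | base => rfl
    | pred c hc ih =>
      have h1 := hGl (c - 1)
      have h2 := hl0 (c - 1) (by omega)
      rw [sub_add_cancel] at h1
      omega
  have hL1 : ∀ c, p ≤ c → c ≤ q + 1 → Gl c = Gl p - (c - p) := by
    intro c hc
    induction c, hc using Int.leInduction with
    | base => intro _; omega
    | succ c hc ih =>
      intro hcq
      have h1 := hGl c
      have h2 := hl1 c hc (by omega)
      have h3 := ih (by omega)
      omega
  have hH0 : ∀ c, q' + 1 ≤ c → Gh c = Gh (q' + 1) := by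
    intro c hc
    induction c, hc using Int.leInduction with
    | base => rfl
    | succ c hc ih =>
      have h1 := hGh c
      have h2 := hh0 c (by omega)
      omega
  have hH1 : ∀ c, c ≤ q' + 1 → p' ≤ c → Gh c = Gh (q' + 1) - (q' + 1 - c) := by
    intro c hc
    induction c, hc using Int.leInductionDown with
    | base => intro _; omega
    | pred c hc ih =>
      intro hcp
      have h1 := hGh (c - 1)
      have h2 := hh1 (c - 1) hcp (by omega)
      have h3 := ih (by omega)
      rw [sub_add_cancel] at h1
      omega
  obtain ⟨hmin, hlast⟩ := h
  have hl : ∀ c, p' ≤ c → c ≤ q + 1 → Gl c = Gl p - max (c - p) 0 := fun c h1 h2 => by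
    rcases le_total c p with h | h
    · have := hL0 c h
      omega
    · have := hL1 c h h2
      omega
  have hh : ∀ c, p' ≤ c → Gh c = Gh (q' + 1) - max (q' + 1 - c) 0 := fun c h1 => by
    rcases le_total c (q' + 1) with h | h
    · have := hH1 c h h1
      omega
    · have := hH0 c h
      omega
  have hl1' := hl (q + 1) (by omega) le_rfl
  have hh1' := hh (q + 1) (by omega)
  have hl2' := hl p' le_rfl (by omega)
  have hh2' := hh p' le_rfl
  have hmin1 := hmin (q + 1)
  have hmin2 := hmin p'
  have hlast1 := hlast (q + 1)
  have hlast2 := hlast p'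
  simp only at hmin1 hmin2 hlast1 hlast2
  by_cases hcase : q + 1 ≤ c₀
  · left
    have hc0 := hh c₀ (by omega)
    have hc0' := hh (c₀ - 1) (by omega)
    refine ⟨hcase, fun c => ?_, fun c hc => ?_⟩
    · have h1 := hmin c
      have h2 := hmin (c - 1)
      simp only at h1 h2 ⊢
      rcases le_or_gt c (p' + 1) with hc | hc
      · have h3 := hL0 c (by omega)
        have h4 := hL0 (c - 1) (by omega)
        omega
      · have h3 := hh (c - 1) (by omega)
        have h4 := hh c (by omega)
        rcases le_or_gt c (q + 1) with hcq | hcq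
        · have h5 := hl c (by omega) hcq
          omega
        · omega
    · have h1 := hlast c hc
      have h3 := hh (c - 1) (by omega)
      have h4 := hh c (by omega)
      simp only at h1 ⊢
      omega
  · right
    have hc0p : c₀ ≤ p' := by
      by_contra hlt
      have h5 := hl c₀ (by omega) (by omega)
      have h6 := hh c₀ (by omega)
      omega
    have hv := hL0 (c₀ + 1) (by omega)
    have hv' := hL0 c₀ (by omega)
    refine ⟨hc0p, ⟨fun c => ?_, fun c hc => ?_⟩, fun hp => ?_⟩
    · have h1 := hmin c
      have h2 := hmin (c - 1)
      simp only [add_sub_cancel_right] at h1 h2 ⊢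
      rcases le_or_gt c (p' + 1) with hc | hc
      · have h3 := hL0 c (by omega)
        have h4 := hL0 (c - 1) (by omega)
        omega
      · have h3 := hh (c - 1) (by omega)
        have h4 := hh c (by omega)
        rcases le_or_gt c (q + 1) with hcq | hcq
        · have h5 := hl c (by omega) hcq
          omega
        · omega
    · have h1 := hlast c (by omega)
      have h2 := hlast (c - 1) (by omega)
      simp only [add_sub_cancel_right] at h1 h2 ⊢
      rcases le_or_gt c (p' + 1) with hc | hc
      · have h3 := hL0 c (by omega)
        have h4 := hL0 (c - 1) (by omega)
        omega
      · have h3 := hh (c - 1) (by omega)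
        have h4 := hh c (by omega)
        rcases le_or_gt c (q + 1) with hcq | hcq
        · have h5 := hl c (by omega) hcq
          omega
        · omega
    · by_contra hlt
      obtain rfl : c₀ = p' := by omega
      omega

theorem front_congr {e : ℕ} {s : Fin (l + 1) → ℤ} {Λ : MultiPartition l} {c d : ℤ}
    (h : rowComp l d = rowComp l c) :
    ∃ k, ∀ v m, front e s Λ v (d + m) = front e s Λ v (c + m) + e * k := by
  refine ⟨rowLevel l d - rowLevel l c, fun v m => ?_⟩
  rw [← front_turn_mul]
  congr 1
  have h1 := rowComp_add_rowLevel l c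
  have h2 := rowComp_add_rowLevel l d
  rw [h] at h2
  linear_combination h2 - h1

theorem front_addNode {e : ℕ} {s : Fin (l + 1) → ℤ} {Λ Λ' : MultiPartition l} {γ : Node l}
    (hγ : Addable Λ γ) (h : AddNode Λ Λ' γ) {v : ℕ} (hv : 1 ≤ v) (c : ℤ) :
    front e s Λ' v c =
      front e s Λ v c - if rowComp l c = γ.comp ∧ v = γ.col then 1 else 0 := by
  rw [front, front, colLength_addNode hγ h _ hv]
  split_ifs <;> push_cast <;> ring

theorem bead_le_bead (e : ℕ) (s : Fin (l + 1) → ℤ) (Λ : MultiPartition l) {b b' : ℕ} (c : ℤ)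
    (hb : 1 ≤ b) (hbb : b ≤ b') : bead e s Λ b c ≤ bead e s Λ b' c := by
  have := front_le_front e s Λ c hb hbb
  simp only [bead]
  omega

/-- Adding the good addable node preserves the monotonicity of the fronts. -/
theorem monotone_front_addNode {e : ℕ} {s : Fin (l + 1) → ℤ} {Λ Λ' : MultiPartition l}
    (hmono : ∀ v, 1 ≤ v → Monotone (front e s Λ v)) {γ : Node l} (hadd : AddNode Λ Λ' γ)
    {t c₀ : ℤ} {G : ℤ → ℤ} (hG : ∀ c, G (c + 1) = G c + beadWeight e s Λ Set.univ t c)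
    (hmin : LastMin G c₀) (hγ : LetterAt e s Λ t c₀ (γ, Letter.A)) {v : ℕ} (hv : 1 ≤ v) :
    Monotone (front e s Λ' v) := by
  have hA : Addable Λ γ := by simpa using hγ.2.2
  obtain ⟨hcomp, -, hcol, hbead, hno⟩ := (letterAt_A_iff ..).1 hγ
  refine monotone_int_of_le_succ fun c => ?_
  rw [front_addNode hA hadd hv, front_addNode hA hadd hv]
  have hstep := hmono v hv (show c ≤ c + 1 by omega)
  by_contra hlt
  have hc : rowComp l (c + 1) = γ.comp ∧ v = γ.col := by
    by_contra hc
    rw [if_neg hc] at hlt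
    split_ifs at hlt <;> omega
  rw [if_pos hc] at hlt
  have heq : front e s Λ v c = front e s Λ v (c + 1) := by
    split_ifs at hlt <;> omega
  obtain ⟨hc1, rfl⟩ := hc
  obtain ⟨k, hk⟩ := front_congr (e := e) (s := s) (Λ := Λ) (hc1.trans hcomp)
  have h1 := hk γ.col 0
  have h2 := hk γ.col (-1)
  rw [show c + 1 + -1 = c by ring] at h2
  rw [add_zero, add_zero] at h1
  have hpos : bead e s Λ γ.col (c₀ - 1) = t + 1 := by
    simp only [bead, sub_eq_add_neg] at hbead ⊢
    omega
  have hw : beadWeight e s Λ Set.univ t (c₀ - 1) = 1 := by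
    rw [beadWeight, beadCount_eq_one hcol (Set.mem_univ _) hpos, beadCount_eq_zero]
    · rfl
    · intro b hb _ hbt
      have h3 := hno b hb
      have h4 := hmono b hb (show c₀ - 1 ≤ c₀ by omega)
      have h5 : b < γ.col := by
        by_contra h
        have := bead_le_bead e s Λ (c₀ - 1) hcol (not_lt.1 h)
        omega
      have h6 := bead_lt_bead e s Λ c₀ hb h5
      simp only [bead] at *
      omega
  have h3 := hG (c₀ - 1)
  have h4 := hmin.1 (c₀ - 1)
  rw [sub_add_cancel, hw] at h3
  omega

/-- If the parts of size `β` cover all residues after adding the good addable node, they already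
cover all residues before. -/
theorem covers_of_covers_addNode {e : ℕ} (he : 2 ≤ e) {s : Fin (l + 1) → ℤ}
    {Λ Λ' : MultiPartition l} (hmono : ∀ v, 1 ≤ v → Monotone (front e s Λ v)) {γ : Node l}
    (hadd : AddNode Λ Λ' γ) {t c₀ : ℤ} {G : ℤ → ℤ}
    (hG : ∀ c, G (c + 1) = G c + beadWeight e s Λ Set.univ t c)
    (hmin : LastMin G c₀) (hγ : LetterAt e s Λ t c₀ (γ, Letter.A)) {β : ℕ} (hβ : 1 ≤ β)
    (hcov : ∀ c, front e s Λ' β (c + 1) ≤ front e s Λ' (β + 1) c) :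
    ∀ c, front e s Λ β (c + 1) ≤ front e s Λ (β + 1) c := by
  have hA : Addable Λ γ := by simpa using hγ.2.2
  obtain ⟨hcomp, -, hcol, hbead, hno⟩ := (letterAt_A_iff ..).1 hγ
  intro c
  by_contra hlt
  have hcov' := hcov c
  rw [front_addNode hA hadd hβ, front_addNode hA hadd (by omega)] at hcov'
  have hc : rowComp l (c + 1) = γ.comp ∧ β = γ.col := by
    by_contra hc
    rw [if_neg hc] at hcov'
    split_ifs at hcov' <;> omega
  rw [if_pos hc, if_neg (by omega)] at hcov'
  obtain ⟨hc1, rfl⟩ := hc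
  have hcov₁ : ∀ d, rowComp l (d + 1) ≠ γ.comp →
      front e s Λ γ.col (d + 1) ≤ front e s Λ (γ.col + 1) d := by
    intro d hd
    have := hcov d
    rw [front_addNode hA hadd hβ, front_addNode hA hadd (by omega), if_neg (by tauto),
      if_neg (by omega)] at this
    omega
  have hstart : bead e s Λ (γ.col + 1) (c₀ - 1) = t + 1 := by
    obtain ⟨k, hk⟩ := front_congr (e := e) (s := s) (Λ := Λ) (hc1.trans hcomp)
    have h1 := hk γ.col 0
    have h2 := hk (γ.col + 1) (-1)
    rw [show c + 1 + -1 = c by ring] at h2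
    rw [add_zero, add_zero] at h1
    simp only [bead, sub_eq_add_neg] at hbead ⊢
    push_cast
    omega
  have hdesc : ∀ n : ℕ, bead e s Λ (γ.col + 1) (c₀ - 1 - n) = t + 1 ∧ G (c₀ - n) = G c₀ := by
    intro n
    induction n with
    | zero => simpa using hstart
    | succ n ih =>
      obtain ⟨h1, h2⟩ := ih
      set d := c₀ - 1 - (n : ℤ) with hd
      have hd1 : c₀ - (n : ℤ) = d + 1 := by omega
      have hd2 : c₀ - ((n + 1 : ℕ) : ℤ) = d := by push_cast; omega
      have hd3 : c₀ - 1 - ((n + 1 : ℕ) : ℤ) = d - 1 := by push_cast; omega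
      rw [hd1] at h2
      rw [hd2, hd3]
      have hstep := hG d
      have hmind := hmin.1 d
      have hone := beadCount_eq_one (S := Set.univ) (by omega) (Set.mem_univ _) h1
      have hbd : bead e s Λ γ.col d = t := by
        by_contra hne
        have h3 := bead_lt_bead e s Λ d hcol (show γ.col < γ.col + 1 by omega)
        have hzero : beadCount e s Λ Set.univ t d = 0 := beadCount_eq_zero fun b hb _ hbt => by
          rcases Nat.lt_or_ge γ.col b with h | h
          · have := bead_le_bead e s Λ d (by omega) (show γ.col + 1 ≤ b by omega)
            omega
          · have := bead_le_bead e s Λ d hb h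
            omega
        rw [beadWeight, hone, hzero] at hstep
        omega
      rw [beadWeight, hone, beadCount_eq_one hcol (Set.mem_univ _) hbd] at hstep
      refine ⟨?_, by omega⟩
      have hne : rowComp l (d - 1 + 1) ≠ γ.comp := by
        rw [sub_add_cancel]
        intro h
        obtain ⟨k, hk⟩ := front_congr (e := e) (s := s) (Λ := Λ) (h.trans hcomp)
        have h4 := hk γ.col 0
        rw [add_zero, add_zero] at h4
        have h5 : (e : ℤ) * k = -1 := by
          simp only [bead] at hbead hbd
          omega
        have h6 : (e : ℤ) ∣ 1 := ⟨-k, by rw [mul_neg, h5]; rfl⟩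
        have := Int.le_of_dvd one_pos h6
        omega
      have h3 := hcov₁ _ hne
      have h4 := hmono (γ.col + 1) (by omega) (show d - 1 ≤ d by omega)
      rw [sub_add_cancel] at h3
      simp only [bead] at hbd h1 ⊢
      push_cast at h1 ⊢
      omega
  have h1 := (hdesc (l + 1)).1
  have h2 := front_turn e s Λ (γ.col + 1) (c₀ - 1 - (l + 1 : ℕ))
  rw [show c₀ - 1 - ((l + 1 : ℕ) : ℤ) + ((l : ℤ) + 1) = c₀ - 1 by push_cast; ring] at h2
  simp only [bead] at h1 hstart
  omega

/-- The last minimum of the potential of `Λ` moves to the last minimum of the potential of its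
reduction, following the bead that is moved by the crystal operator. -/
theorem lastMin_reduction {e : ℕ} (he : 0 < e) {s : Fin (l + 1) → ℤ} {Λ : MultiPartition l}
    (hmono : ∀ v, 1 ≤ v → Monotone (front e s Λ v)) {α : ℕ} (hα : 1 ≤ α)
    (hcov : ∀ c, front e s Λ α (c + 1) ≤ front e s Λ (α + 1) c) {t c₀ : ℤ} {γ : Node l}
    {Gl Gh : ℤ → ℤ} (hGl : ∀ c, Gl (c + 1) = Gl c + beadWeight e s Λ (Set.Iic α) t c)
    (hGh : ∀ c, Gh (c + 1) = Gh c + beadWeight e s Λ (Set.Iic α)ᶜ t c)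
    (hmin : LastMin (fun c => Gl c + Gh c) c₀) (hγ : LetterAt e s Λ t c₀ (γ, Letter.A)) :
    (γ.col ≤ α ∧ LastMin (fun c => Gl c + Gh (c - 1)) c₀) ∨
      (α < γ.col ∧ LastMin (fun c => Gl c + Gh (c - 1)) (c₀ + 1) ∧
        (γ.col = α + 1 → front e s Λ α (c₀ + 1) < front e s Λ (α + 1) c₀)) := by
  obtain ⟨-, -, hcol, hbead, -⟩ := (letterAt_A_iff ..).1 hγ
  obtain ⟨q, hq⟩ := exists_front_threshold he (hmono α hα) (t - α)
  obtain ⟨p, hp⟩ := exists_front_threshold he (hmono α hα) (t - 1 - α)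
  obtain ⟨q', hq'⟩ := exists_front_threshold he (hmono (α + 1) (by omega)) (t + 1 - (α + 1))
  obtain ⟨p', hp'⟩ := exists_front_threshold he (hmono (α + 1) (by omega)) (t - (α + 1))
  have hlow : ∀ c b, 1 ≤ b → b ∈ Set.Iic α → bead e s Λ b c ≤ α + front e s Λ α c :=
    fun c b hb hbα => bead_le_bead e s Λ c hb hbα
  have hhigh : ∀ c b, 1 ≤ b → b ∈ (Set.Iic α)ᶜ →
      α + 1 + front e s Λ (α + 1) c ≤ bead e s Λ b c := fun c b hb hbα => by
    have := bead_le_bead e s Λ c (show 1 ≤ α + 1 by omega)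
      (show α + 1 ≤ b by simpa using hbα)
    simp only [bead] at this ⊢
    push_cast at this
    omega
  have hpq := (hp p).2 le_rfl
  have hpq' := (hp' p').2 le_rfl
  have hqp := hq p
  have hqp' := hq' p'
  have hpp : p' < p := by
    have h1 := hcov p
    have h2 := hp (p + 1)
    have h3 := hp' p
    omega
  have hqq : q' < q := by
    have h1 := hcov q
    have h2 := hq (q + 1)
    have h3 := hq' q
    omega
  have hshift := lastMin_shift hGl hGh (p := p + 1) (q := q) (p' := p' + 1) (q' := q')
    (by omega) (by omega) (by omega) hqq ?_ ?_ ?_ ?_ hmin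
  · rcases hshift with ⟨h1, h2⟩ | ⟨h1, h2, h3⟩
    · refine Or.inl ⟨?_, h2⟩
      by_contra hlt
      have h4 := hhigh c₀ γ.col hcol (by simpa using hlt)
      have h5 := hcov (c₀ - 1)
      have h6 := hq c₀
      have h7 := hq' c₀
      omega
    · refine Or.inr ⟨?_, h2, fun hαγ => ?_⟩
      · by_contra hlt
        have h4 := hlow c₀ γ.col hcol (not_lt.1 hlt)
        have h6 := hp c₀
        omega
      · have h4 := hp (c₀ + 1)
        have h5 := hp' c₀
        rw [hαγ] at hbead
        simp only [bead] at hbead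
        push_cast at hbead
        omega
  · intro c hc
    have h1 := hp c
    rw [beadWeight, beadCount_eq_zero, beadCount_eq_zero]
    · rfl
    all_goals
      intro b hb hbα
      have := hlow c b hb hbα
      omega
  · intro c hc hcq
    have h1 := hp c
    have h2 := hq c
    rw [beadWeight, beadCount_eq_zero, beadCount_eq_one hα (Set.mem_Iic.2 le_rfl)]
    · rfl
    · simp only [bead]
      omega
    · intro b hb hbα
      have := hlow c b hb hbα
      omega
  · intro c hc
    have h1 := hq' c
    rw [beadWeight, beadCount_eq_zero, beadCount_eq_zero]
    · rfl
    all_goals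
      intro b hb hbα
      have := hhigh c b hb hbα
      omega
  · intro c hc hcq
    have h1 := hp' c
    have h2 := hq' c
    rw [beadWeight, beadCount_eq_one (b := α + 1) (by omega) (by simp), beadCount_eq_zero]
    · rfl
    · intro b hb hbα
      have := hhigh c b hb hbα
      omega
    · simp only [bead]
      push_cast
      omega

/-!
STATEMENT 18 (Theorem 5.5 of the paper): the reduction ψ commutes with the crystal
operators f̃_i: if γ is the good addable i-node of the cylindric non-FLOTW (λ, s) and
λ' = f̃_i λ, then ψ(λ) = μ has a good addable i-node δ, and the multipartition μ'
obtained by adding δ to μ equals the reduction ψ(λ') of λ' (taken with respect to the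
first pseudoperiod of λ', which exists).
-/
theorem reduction_commutes_with_crystal_operators
    (l e : ℕ) (he : 2 ≤ e) (s : Fin (l + 1) → ℤ) (Λ μ : MultiPartition l)
    (α : ℕ) (P : ℕ → Node l)
    (hs : InSe e s) (hcyl : Cylindric e s Λ) (hnf : ¬ FLOTW e s Λ)
    (hP : IsFirstPseudoperiod e s Λ α P)
    (hμ : IsPsi e P α Λ μ) :
    ∀ i : ℕ, i < e → ∀ (γ : Node l) (Λ' : MultiPartition l),
      GoodAddable Λ s e (i : ℤ) γ → AddNode Λ Λ' γ →
      ∃ (δ : Node l) (μ' : MultiPartition l),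
        GoodAddable μ (xiCharge e s) e (i : ℤ) δ ∧ AddNode μ μ' δ ∧
        ∃ (α' : ℕ) (P' : ℕ → Node l),
          IsFirstPseudoperiod e s Λ' α' P' ∧ IsPsi e P' α' Λ' μ' := by
  intro i hi γ Λ' hγ hadd
  have he0 : 0 < e := by omega
  have hα := hP.1
  have hmono : ∀ v, 1 ≤ v → Monotone (front e s Λ v) := fun v hv =>
    front_monotone_of_cylindric hs hcyl hv
  have hcov := (covers_iff he0 hmono hα).1 hP.2.1
  have hfront := (isPsi_iff he0 hmono hP).1 hμ
  have hbeadμ : ∀ b, 1 ≤ b → ∀ c, bead e (xiCharge e s) μ b c =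
      if b ≤ α then bead e s Λ b c else bead e s Λ b (c - 1) := fun b hb c => by
    simp only [bead, hfront b hb c]
    split_ifs <;> rfl
  obtain ⟨Gl, hGl⟩ := exists_potential (beadWeight e s Λ (Set.Iic α) i)
  obtain ⟨Gh, hGh⟩ := exists_potential (beadWeight e s Λ (Set.Iic α)ᶜ i)
  have hG : ∀ c, (fun c => Gl c + Gh c) (c + 1) =
      (fun c => Gl c + Gh c) c + beadWeight e s Λ Set.univ i c := fun c => by
    rw [beadWeight_univ e s Λ (Set.Iic α)]
    simp only [hGl, hGh]
    ring
  have hGμ : ∀ c, (fun c => Gl c + Gh (c - 1)) (c + 1) =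
      (fun c => Gl c + Gh (c - 1)) c + beadWeight e (xiCharge e s) μ Set.univ i c := fun c => by
    have hlow : ∀ t, beadCount e (xiCharge e s) μ (Set.Iic α) t c =
        beadCount e s Λ (Set.Iic α) t c := fun t => by
      simp only [beadCount]
      congr 1
      refine propext (exists_congr fun b => and_congr_right fun hb => and_congr_right fun hbα => ?_)
      rw [hbeadμ b hb, if_pos (Set.mem_Iic.1 hbα)]
    have hhigh : ∀ t, beadCount e (xiCharge e s) μ (Set.Iic α)ᶜ t c =
        beadCount e s Λ (Set.Iic α)ᶜ t (c - 1) := fun t => by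
      simp only [beadCount]
      congr 1
      refine propext (exists_congr fun b => and_congr_right fun hb => and_congr_right fun hbα => ?_)
      rw [hbeadμ b hb, if_neg (by simpa using hbα)]
    have h1 := hGh (c - 1)
    rw [sub_add_cancel] at h1
    rw [beadWeight_univ _ _ _ (Set.Iic α)]
    simp only [beadWeight] at hGl h1 ⊢
    rw [hlow, hlow, hhigh, hhigh, hGl, add_sub_cancel_right, h1]
    ring
  obtain ⟨c₀, hmin, hletter⟩ :=
    (goodAddable_iff (G := fun c => Gl c + Gh c) he0 s Λ (by omega) (by omega) hG γ).1 hγ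
  have hA : Addable Λ γ := by simpa using hletter.2.2
  obtain ⟨hcomp, -, hcol, hbead, -⟩ := (letterAt_A_iff ..).1 hletter
  have hred := lastMin_reduction he0 hmono hα hcov hGl hGh hmin hletter
  obtain ⟨c₁, hmin₁, hc₁, hbead₁⟩ : ∃ c₁, LastMin (fun c => Gl c + Gh (c - 1)) c₁ ∧
      (c₁ = if γ.col ≤ α then c₀ else c₀ + 1) ∧
      bead e (xiCharge e s) μ γ.col c₁ = i + 1 := by
    rcases hred with ⟨h1, h2⟩ | ⟨h1, h2, -⟩
    · refine ⟨c₀, h2, by rw [if_pos h1], ?_⟩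
      rw [hbeadμ _ hcol, if_pos h1, hbead]
    · refine ⟨c₀ + 1, h2, by rw [if_neg (by omega)], ?_⟩
      rw [hbeadμ _ hcol, if_neg (by omega), add_sub_cancel_right, hbead]
  have hweight : beadWeight e (xiCharge e s) μ Set.univ i c₁ = 1 := by
    have h1 := hGμ c₁
    have h2 := hmin₁.2 (c₁ + 1) (by omega)
    have h3 : beadCount e (xiCharge e s) μ Set.univ (i + 1) c₁ = 1 :=
      beadCount_eq_one hcol (Set.mem_univ _) hbead₁
    have h4 : 0 ≤ beadCount e (xiCharge e s) μ Set.univ i c₁ := by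
      rw [beadCount]
      split_ifs <;> omega
    simp only [beadWeight] at h1 h2 ⊢
    omega
  obtain ⟨δ, hδ⟩ := exists_letterAt_A hweight
  have hδA : Addable μ δ := by simpa using hδ.2.2
  obtain ⟨hδcomp, -, hδcol, hδbead, -⟩ := (letterAt_A_iff ..).1 hδ
  have hcols : δ.col = γ.col := bead_inj hδcol hcol (hδbead.trans hbead₁.symm)
  obtain ⟨μ', hμ'⟩ := exists_addNode hδA
  refine ⟨δ, μ', (goodAddable_iff (G := fun c => Gl c + Gh (c - 1)) he0 _ μ (by omega) (by omega)
    hGμ δ).2 ⟨c₁, hmin₁, hδ⟩, hμ', α, ?_⟩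
  have hmono' : ∀ v, 1 ≤ v → Monotone (front e s Λ' v) := fun v hv =>
    monotone_front_addNode (G := fun c => Gl c + Gh c) hmono hadd hG hmin hletter hv
  have hcov' : ∀ c, front e s Λ' α (c + 1) ≤ front e s Λ' (α + 1) c := by
    intro c
    have h1 := hcov c
    rw [front_addNode hA hadd hα, front_addNode hA hadd (by omega)]
    by_cases hc : rowComp l c = γ.comp ∧ α + 1 = γ.col
    · rw [if_pos hc, if_neg (by omega)]
      rcases hred with ⟨h2, -⟩ | ⟨-, -, h2⟩
      · omega
      · have h3 := h2 hc.2.symm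
        obtain ⟨k, hk⟩ := front_congr (e := e) (s := s) (Λ := Λ) (hc.1.trans hcomp)
        have h4 := hk α 1
        have h5 := hk (α + 1) 0
        rw [add_zero, add_zero] at h5
        omega
    · rw [if_neg hc]
      split_ifs <;> omega
  have hcovers' := (covers_iff he0 hmono' hα).2 hcov'
  have hmax' : ∀ β, α < β → ¬ Covers e s Λ' β := fun β hβ h => by
    have hβ1 : 1 ≤ β := by omega
    exact hP.2.2.1 β hβ ((covers_iff he0 hmono hβ1).2 (covers_of_covers_addNode
      (G := fun c => Gl c + Gh c) he hmono hadd hG hmin hletter hβ1 ((covers_iff he0 hmono' hβ1).1 h)))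
  obtain ⟨P', hP'⟩ := exists_topNodes he0 hmono' hα hcov'
  have hfirst := isFirstPseudoperiod_topNodes he0 hmono' hα hcovers' hmax' hP'
  refine ⟨P', hfirst, (isPsi_iff he0 hmono' hfirst).2 fun v hv c => ?_⟩
  rw [front_addNode hδA hμ' hv, hfront v hv, front_addNode hA hadd hv, front_addNode hA hadd hv,
    hcols, hδcomp, hcomp, hc₁]
  have hpred : rowComp l (c - 1) = rowComp l c₀ ↔ rowComp l c = rowComp l (c₀ + 1) := by
    rw [rowComp_pred, prevComp, rowComp_succ, Equiv.symm_apply_eq]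
  simp only [hpred]
  by_cases hvγ : v = γ.col
  · subst hvγ
    split_ifs <;> simp_all
  · simp [hvγ]

end FockCrystal
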